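/- arXiv:2202.04481 — 2 statements merged into one kernel-verified Lean document; each statement's English description precedes it below -/
import Mathlib

section
/- For every fixed d > 0, lim_{n→∞} inf over deterministic prefix d-semifaithful codes (φ_n, f_n, g_n) in the universal distortion setting of sup_{p ∈ P(A), ρ ∈ D} [ (ln 2 / n)·E_p[ l(f_n(φ_n(X^n, ρ))) ] − R(p,d,ρ) ] = 0; i.e., there exist prefix d-semifaithful codes whose expected rate converges to the rate-distortion function uniformly over all source distributions and all distortion measures in D. -/
open Filter MeasureTheory
open scoped BigOperators

noncomputable section

variable {A B : Type*}

/-- `p` is a probability distribution on the finite alphabet `A`. -/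
def IsProb [Fintype A] (p : A → ℝ) : Prop :=
  (∀ a, 0 ≤ p a) ∧ ∑ a, p a = 1

/-- `Q` is a conditional probability distribution from `A` to `B`. -/
def IsCondProb [Fintype A] [Fintype B] (Q : A → B → ℝ) : Prop :=
  ∀ j, IsProb (Q j)

/-- `ρ` is a distortion measure in the class `D`: bounded in `[0, ρmax]` and
with `max_j min_k ρ(j,k) = 0` (equivalently, every row contains a zero). -/
def IsDistMeasure [Fintype A] [Fintype B] (ρmax : ℝ) (ρ : A → B → ℝ) : Prop :=
  (∀ j k, 0 ≤ ρ j k ∧ ρ j k ≤ ρmax) ∧ ∀ j, ∃ k, ρ j k = 0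

/-- Mutual information `I(p, Q)` in nats. -/
def mutualInfo [Fintype A] [Fintype B] (p : A → ℝ) (Q : A → B → ℝ) : ℝ :=
  ∑ j, ∑ k, p j * Q j k * Real.log (Q j k / ∑ j', p j' * Q j' k)

/-- Average distortion `Σ_{j,k} p(j) Q(k|j) ρ(j,k)`. -/
def avgDist [Fintype A] [Fintype B] (p : A → ℝ) (Q : A → B → ℝ) (ρ : A → B → ℝ) : ℝ :=
  ∑ j, ∑ k, p j * Q j k * ρ j k

/-- The rate-distortion function `R(p,d,ρ)` in nats. -/
def RD [Fintype A] [Fintype B] (p : A → ℝ) (d : ℝ) (ρ : A → B → ℝ) : ℝ :=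
  sInf { r | ∃ Q, IsCondProb Q ∧ avgDist p Q ρ ≤ d ∧ r = mutualInfo p Q }

/-- The type (empirical distribution) of a sequence `x ∈ A^n`. -/
def typeOf [DecidableEq A] {n : ℕ} (x : Fin n → A) : A → ℝ :=
  fun a => ((Finset.univ.filter fun i => x i = a).card : ℝ) / n

/-- The i.i.d. product probability `p^n(x) = ∏ i p(x_i)`. -/
def prodProb {n : ℕ} (p : A → ℝ) (x : Fin n → A) : ℝ :=
  ∏ i, p (x i)

/-- The `n`-fold single-letter distortion `ρ_n(x,y) = (1/n) Σ_i ρ(x_i, y_i)`. -/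
def nDist {n : ℕ} (ρ : A → B → ℝ) (x : Fin n → A) (y : Fin n → B) : ℝ :=
  (∑ i, ρ (x i) (y i)) / n

/-- `E_p[R(T,d,ρ)]`, the expectation of the empirical rate-distortion function
over `X^n` i.i.d. `p` (written as a sum over sequences). -/
def expTypeRD [Fintype A] [DecidableEq A] [Fintype B] (n : ℕ) (p : A → ℝ)
    (d : ℝ) (ρ : A → B → ℝ) : ℝ :=
  ∑ x : Fin n → A, prodProb p x * RD (typeOf x) d ρ


/-- Kraft's inequality (converse part): lengths satisfying it come from a prefix code. -/
theorem kraft_aux {Y : Type*} [DecidableEq Y] (L : Y → ℕ) (s : Finset Y) :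
    (∑ y ∈ s, (1/2:ℝ)^(L y) ≤ 1) →
    ∃ f : Y → List Bool, (∀ y ∈ s, (f y).length = L y) ∧
      ∀ y ∈ s, ∀ z ∈ s, f y <+: f z → y = z := by
  induction s using Finset.induction_on_max_value L with
  | empty => intro _; exact ⟨fun _ => [], by simp, by simp⟩
  | insert a s ha hmax ih =>
    intro h
    rw [Finset.sum_insert ha] at h
    have hpos : (0:ℝ) < (1/2:ℝ)^(L a) := by positivity
    obtain ⟨f, hf1, hf2⟩ := ih (by linarith)
    -- find a word
    have key : ∃ w : List.Vector Bool (L a), ∀ y ∈ s, ¬ f y <+: w.toList := by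
      by_contra hcon
      push Not at hcon
      have hcov : (Finset.univ : Finset (List.Vector Bool (L a))) ⊆
          s.biUnion (fun y => Finset.univ.filter (fun w => f y <+: w.toList)) := by
        intro w _
        obtain ⟨y, hy, hw⟩ := hcon w
        simp only [Finset.mem_biUnion, Finset.mem_filter, Finset.mem_univ, true_and]
        exact ⟨y, hy, hw⟩
      have h1 := Finset.card_le_card hcov
      have h2 := h1.trans Finset.card_biUnion_le
      have h3 : ∀ y ∈ s, (Finset.univ.filter
          (fun w : List.Vector Bool (L a) => f y <+: w.toList)).card ≤ 2^(L a - L y) := by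
        intro y hy
        have : (Finset.univ.filter
          (fun w : List.Vector Bool (L a) => f y <+: w.toList)).card ≤
          (Finset.univ : Finset (List.Vector Bool (L a - L y))).card := by
          apply Finset.card_le_card_of_injOn
            (fun w => ⟨w.toList.drop (L y), by simp⟩)
          · intro w _; exact Finset.mem_coe.2 (Finset.mem_univ _)
          · intro w hw v hv hwv
            simp only [Finset.coe_filter, Finset.mem_univ, true_and, Set.mem_ofPred_eq] at hw hv
            replace hwv : w.toList.drop (L y) = v.toList.drop (L y) := congrArg Subtype.val hwv
            obtain ⟨u, hu⟩ := hw
            obtain ⟨u', hu'⟩ := hv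
            apply Subtype.ext
            change w.toList = v.toList
            rw [← hu, ← hu', ← hf1 y hy, List.drop_left, List.drop_left] at hwv
            rw [← hu, ← hu', hwv]
        simpa using this
      have h4 := h2.trans (Finset.sum_le_sum h3)
      simp only [Finset.card_univ, card_vector, Fintype.card_bool] at h4
      have h5 : (2:ℝ)^(L a) ≤ ∑ y ∈ s, (2:ℝ)^(L a - L y) := by exact_mod_cast h4
      have h6 : ∑ y ∈ s, (2:ℝ)^(L a - L y) = 2^(L a) * ∑ y ∈ s, (1/2:ℝ)^(L y) := by
        rw [Finset.mul_sum]
        refine Finset.sum_congr rfl fun y hy => ?_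
        rw [pow_sub₀ _ (by norm_num) (hmax y hy)]
        simp
      rw [h6] at h5
      have : (1:ℝ) ≤ ∑ y ∈ s, (1/2:ℝ)^(L y) := by
        have h2pos : (0:ℝ) < 2^(L a) := by positivity
        by_contra hlt
        push Not at hlt
        nlinarith
      linarith
    obtain ⟨w, hw⟩ := key
    refine ⟨Function.update f a w.toList, ?_, ?_⟩
    · intro y hy
      by_cases hya : y = a
      · subst hya; simp
      · rw [Function.update_of_ne hya]
        exact hf1 y (by simpa [hya] using hy)
    · intro y hy z hz hyz
      by_cases hya : y = a
      · by_cases hza : z = a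
        · rw [hya, hza]
        · exfalso
          have hzs : z ∈ s := by simpa [hza] using hz
          subst hya
          rw [Function.update_self, Function.update_of_ne hza] at hyz
          have hl := hyz.length_le
          have hm := hmax z hzs
          have hz1 := hf1 z hzs
          have heq : w.toList = f z := hyz.eq_of_length (by
            have := w.toList_length
            omega)
          exact hw z hzs (by rw [heq])
      · have hys : y ∈ s := by simpa [hya] using hy
        by_cases hza : z = a
        · exfalso
          subst hza
          rw [Function.update_self, Function.update_of_ne hya] at hyz
          exact hw y hys hyz
        · have hzs : z ∈ s := by simpa [hza] using hz
          rw [Function.update_of_ne hya, Function.update_of_ne hza] at hyz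
          exact hf2 y hys z hzs hyz

theorem sum_prod_eq_one {Z : Type*} [Fintype Z] (r : Z → ℝ) (hr : ∑ z, r z = 1) (m : ℕ) :
    ∑ z : Fin m → Z, ∏ i, r (z i) = 1 := by
  rw [← Fintype.sum_pow, hr, one_pow]

/-- Centered i.i.d. sums: mean and second moment. -/
theorem iid_moments {Z : Type*} [Fintype Z] (r : Z → ℝ) (hr : ∑ z, r z = 1)
    (h : Z → ℝ) (hh : ∑ z, r z * h z = 0) (m : ℕ) :
    ∑ z : Fin m → Z, (∏ i, r (z i)) * (∑ i, h (z i))^2 = m * ∑ z, r z * (h z)^2 := by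
  induction m with
  | zero => simp
  | succ m ih =>
    rw [← (Fin.consEquiv (fun _ : Fin (m+1) => Z)).sum_comp, Fintype.sum_prod_type]
    simp only [Fin.consEquiv_apply, Fin.prod_univ_succ, Fin.sum_univ_succ, Fin.cons_zero,
      Fin.cons_succ]
    have e : ∀ a : Z, ∑ y : Fin m → Z, r a * (∏ i, r (y i)) * (h a + ∑ i, h (y i))^2 =
        r a * h a ^2 + 2 * (r a * h a) * (∑ y : Fin m → Z, (∏ i, r (y i)) * ∑ i, h (y i))
          + r a * (∑ y : Fin m → Z, (∏ i, r (y i)) * (∑ i, h (y i))^2) := by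
      intro a
      have : r a * h a ^2 = r a * h a ^2 * ∑ y : Fin m → Z, ∏ i, r (y i) := by
        rw [sum_prod_eq_one r hr]; ring
      rw [this, Finset.mul_sum, Finset.mul_sum, Finset.mul_sum, ← Finset.sum_add_distrib,
        ← Finset.sum_add_distrib]
      refine Finset.sum_congr rfl fun y _ => ?_
      ring
    simp only [e]
    rw [Finset.sum_add_distrib, Finset.sum_add_distrib, ← Finset.sum_mul, ← Finset.mul_sum, hh,
      ← Finset.sum_mul, hr, ih]
    push_cast
    ring

open Classical in
/-- Chebyshev's inequality for i.i.d. sums on a finite alphabet. -/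
theorem iid_cheb {Z : Type*} [Fintype Z] (r : Z → ℝ) (hr0 : ∀ z, 0 ≤ r z) (hr : ∑ z, r z = 1)
    (h : Z → ℝ) (δ : ℝ) (hδ : 0 < δ) (m : ℕ) (hm : 0 < m) :
    ∑ z : Fin m → Z, (∏ i, r (z i)) *
      (if m * (∑ z, r z * h z + δ) < ∑ i, h (z i) then (1:ℝ) else 0) ≤
      (∑ z, r z * (h z - ∑ z, r z * h z)^2) / δ^2 / m := by
  set μ := ∑ z, r z * h z with hμ
  have hc : ∑ z, r z * (h z - μ) = 0 := by
    simp only [mul_sub, Finset.sum_sub_distrib, ← Finset.sum_mul, hr]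
    rw [← hμ]; ring
  have h2 := iid_moments r hr (fun z => h z - μ) hc m
  have hm' : (0:ℝ) < m := by exact_mod_cast hm
  have h3 : (∑ z, r z * (h z - μ)^2) / δ^2 / m =
      ∑ z : Fin m → Z, (∏ i, r (z i)) * ((∑ i, (h (z i) - μ))^2 / (m*δ)^2) := by
    simp only [← mul_div_assoc]
    rw [← Finset.sum_div, h2]
    field_simp
  rw [h3]
  refine Finset.sum_le_sum fun z _ => ?_
  apply mul_le_mul_of_nonneg_left _ (Finset.prod_nonneg fun i _ => hr0 _)
  split_ifs with hif
  · rw [le_div_iff₀ (by positivity), one_mul]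
    apply pow_le_pow_left₀ (by positivity)
    rw [Finset.sum_sub_distrib]
    simp
    nlinarith
  · positivity

open Classical in
/-- Random covering lemma. -/
theorem covering {X Y : Type*} [Fintype X] [Fintype Y] (p : X → ℝ) (hp0 : ∀ x, 0 ≤ p x)
    (hp : ∑ x, p x = 1)
    (Q : X → Y → ℝ) (hQ0 : ∀ x y, 0 ≤ Q x y) (hQ : ∀ x, ∑ y, Q x y = 1)
    (q : Y → ℝ) (hq0 : ∀ y, 0 ≤ q y) (hq : ∑ y, q y = 1) (G : X → Y → Prop)
    (a : ℝ) (N : ℕ) :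
    ∃ c : Fin N → Y, ∑ x, p x * (if ∀ i, ¬ G x (c i) then (1:ℝ) else 0) ≤
      (∑ x, ∑ y, p x * Q x y * (if G x y ∧ a * Q x y ≤ q y then (0:ℝ) else 1)) +
        Real.exp (-(N * a)) := by
  set RHS := (∑ x, ∑ y, p x * Q x y * (if G x y ∧ a * Q x y ≤ q y then (0:ℝ) else 1)) +
        Real.exp (-(N * a)) with hRHS
  by_contra hcon
  push Not at hcon
  have hw : ∑ c : Fin N → Y, ∏ i, q (c i) = 1 := sum_prod_eq_one q hq N
  have hw0 : ∀ c : Fin N → Y, 0 ≤ ∏ i, q (c i) := fun c => Finset.prod_nonneg fun i _ => hq0 _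
  have h1 : RHS < ∑ c : Fin N → Y, (∏ i, q (c i)) *
      ∑ x, p x * (if ∀ i, ¬ G x (c i) then (1:ℝ) else 0) := by
    have : RHS = ∑ c : Fin N → Y, (∏ i, q (c i)) * RHS := by
      rw [← Finset.sum_mul, hw, one_mul]
    rw [this]
    obtain ⟨c, hc⟩ : ∃ c : Fin N → Y, 0 < ∏ i, q (c i) := by
      by_contra hno
      push Not at hno
      have : ∑ c : Fin N → Y, ∏ i, q (c i) ≤ 0 := Finset.sum_nonpos fun c _ => hno c
      linarith
    refine Finset.sum_lt_sum (fun c _ => mul_le_mul_of_nonneg_left (hcon c).le (hw0 c))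
      ⟨c, Finset.mem_univ _, mul_lt_mul_of_pos_left (hcon c) hc⟩
  have h2 : ∑ c : Fin N → Y, (∏ i, q (c i)) *
      ∑ x, p x * (if ∀ i, ¬ G x (c i) then (1:ℝ) else 0) =
      ∑ x, p x * (∑ y, q y * (if G x y then 0 else 1))^N := by
    simp only [Finset.mul_sum]
    rw [Finset.sum_comm]
    refine Finset.sum_congr rfl fun x _ => ?_
    rw [Fintype.sum_pow, Finset.mul_sum]
    refine Finset.sum_congr rfl fun c _ => ?_
    rw [Finset.prod_mul_distrib]
    have : (∏ i, (if G x (c i) then (0:ℝ) else 1)) = if ∀ i, ¬ G x (c i) then (1:ℝ) else 0 := by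
      split_ifs with hif
      · exact Finset.prod_eq_one fun i _ => by simp [hif i]
      · push Not at hif
        obtain ⟨i, hi⟩ := hif
        exact Finset.prod_eq_zero (Finset.mem_univ i) (by simp [hi])
    rw [this]; ring
  have h3 : ∀ x, (∑ y, q y * (if G x y then 0 else 1))^N ≤
      (∑ y, Q x y * (if G x y ∧ a * Q x y ≤ q y then (0:ℝ) else 1)) + Real.exp (-(N * a)) := by
    intro x
    set b := ∑ y, Q x y * (if G x y ∧ a * Q x y ≤ q y then (1:ℝ) else 0) with hb
    have hb0 : 0 ≤ b := Finset.sum_nonneg fun y _ => mul_nonneg (hQ0 _ _) (by split_ifs <;> norm_num)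
    have hb1 : ∑ y, Q x y * (if G x y ∧ a * Q x y ≤ q y then (0:ℝ) else 1) = 1 - b := by
      rw [eq_sub_iff_add_eq, hb, ← Finset.sum_add_distrib]
      refine Eq.trans (Finset.sum_congr rfl fun y _ => ?_) (hQ x)
      split_ifs <;> ring
    have hb2 : 0 ≤ 1 - b := by
      rw [← hb1]
      exact Finset.sum_nonneg fun y _ => mul_nonneg (hQ0 _ _) (by split_ifs <;> norm_num)
    rw [hb1]
    have hs : ∑ y, q y * (if G x y then (0:ℝ) else 1) ≤ 1 - a * b := by
      rw [le_sub_iff_add_le, hb, Finset.mul_sum, ← Finset.sum_add_distrib]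
      refine le_trans (Finset.sum_le_sum fun y _ => ?_) hq.le
      by_cases hG : G x y
      · by_cases hS : a * Q x y ≤ q y
        · simp [hG, hS]
        · simp [hG, hS, hq0 y]
      · simp [hG]
    have hs0 : 0 ≤ ∑ y, q y * (if G x y then (0:ℝ) else 1) :=
      Finset.sum_nonneg fun y _ => mul_nonneg (hq0 _) (by split_ifs <;> norm_num)
    calc (∑ y, q y * (if G x y then (0:ℝ) else 1))^N ≤ (Real.exp (-(a*b)))^N := by
          apply pow_le_pow_left₀ hs0
          have := Real.add_one_le_exp (-(a*b))
          linarith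
      _ = Real.exp ((1-b) * 0 + b * (-(N*a))) := by
          rw [← Real.exp_nat_mul]; congr 1; ring
      _ ≤ (1-b) * Real.exp 0 + b * Real.exp (-(N*a)) := by
          have := convexOn_exp.2 (Set.mem_univ 0) (Set.mem_univ (-(N*a))) hb2 hb0 (by ring)
          simpa only [smul_eq_mul] using this
      _ ≤ _ := by
          rw [Real.exp_zero]
          have := Real.exp_pos (-(N*a))
          nlinarith
  have h4 : ∑ x, p x * (∑ y, q y * (if G x y then (0:ℝ) else 1))^N ≤ RHS := by
    have : RHS = ∑ x, p x * ((∑ y, Q x y * (if G x y ∧ a * Q x y ≤ q y then (0:ℝ) else 1))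
        + Real.exp (-(N * a))) := by
      rw [hRHS]
      simp only [mul_add, Finset.sum_add_distrib, ← Finset.sum_mul, hp, one_mul, Finset.mul_sum,
        mul_assoc]
    rw [this]
    exact Finset.sum_le_sum fun x _ => mul_le_mul_of_nonneg_left (h3 x) (hp0 x)
  linarith


/-- Continuous form of the mutual information. -/
def mi' [Fintype A] [Fintype B] (p : A → ℝ) (Q : A → B → ℝ) : ℝ :=
  ∑ j, ∑ k, p j * (Q j k * Real.log (Q j k)) -
    ∑ k, (∑ j, p j * Q j k) * Real.log (∑ j, p j * Q j k)

theorem marg_pos [Fintype A] [Fintype B] {p : A → ℝ} {Q : A → B → ℝ} (hp : IsProb p)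
    (hQ : IsCondProb Q) {j : A} {k : B} (h : p j * Q j k ≠ 0) : 0 < ∑ j', p j' * Q j' k := by
  have h1 : 0 < p j * Q j k := lt_of_le_of_ne (mul_nonneg (hp.1 j) ((hQ j).1 k)) (Ne.symm h)
  refine lt_of_lt_of_le h1 ?_
  exact Finset.single_le_sum (f := fun j' => p j' * Q j' k)
    (fun j' _ => mul_nonneg (hp.1 j') ((hQ j').1 k)) (Finset.mem_univ j)

theorem mutualInfo_eq [Fintype A] [Fintype B] {p : A → ℝ} {Q : A → B → ℝ} (hp : IsProb p)
    (hQ : IsCondProb Q) : mutualInfo p Q = mi' p Q := by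
  unfold mutualInfo mi'
  have : ∑ k, (∑ j, p j * Q j k) * Real.log (∑ j, p j * Q j k) =
      ∑ j, ∑ k, p j * Q j k * Real.log (∑ j', p j' * Q j' k) := by
    rw [Finset.sum_comm]
    refine Finset.sum_congr rfl fun k _ => ?_
    rw [Finset.sum_mul]
  rw [this, ← Finset.sum_sub_distrib]
  refine Finset.sum_congr rfl fun j _ => ?_
  rw [← Finset.sum_sub_distrib]
  refine Finset.sum_congr rfl fun k _ => ?_
  by_cases h : p j * Q j k = 0
  · rw [h, ← mul_assoc, h]; ring
  · have hq := marg_pos hp hQ h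
    rw [Real.log_div (right_ne_zero_of_mul h) hq.ne']
    ring

theorem continuous_mi' [Fintype A] [Fintype B] :
    Continuous (fun z : (A → ℝ) × (A → B → ℝ) => mi' z.1 z.2) := by
  unfold mi'
  refine Continuous.sub ?_ ?_
  · refine continuous_finsetSum _ fun j _ => continuous_finsetSum _ fun k _ => ?_
    refine Continuous.mul (by fun_prop) ?_
    exact Real.continuous_mul_log.comp
      (f := fun z : (A → ℝ) × (A → B → ℝ) => z.2 j k) (by fun_prop)
  · refine continuous_finsetSum _ fun k _ => ?_
    exact Real.continuous_mul_log.comp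
      (f := fun z : (A → ℝ) × (A → B → ℝ) => ∑ j, z.1 j * z.2 j k) (by fun_prop)

theorem marg_prob [Fintype A] [Fintype B] {p : A → ℝ} {Q : A → B → ℝ} (hp : IsProb p)
    (hQ : IsCondProb Q) : IsProb (fun k => ∑ j, p j * Q j k) := by
  refine ⟨fun k => Finset.sum_nonneg fun j _ => mul_nonneg (hp.1 j) ((hQ j).1 k), ?_⟩
  rw [Finset.sum_comm]
  simp only [← Finset.mul_sum, (hQ _).2, mul_one, hp.2]

theorem mutualInfo_nonneg [Fintype A] [Fintype B] {p : A → ℝ} {Q : A → B → ℝ} (hp : IsProb p)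
    (hQ : IsCondProb Q) : 0 ≤ mutualInfo p Q := by
  have hm := marg_prob hp hQ
  have h1 : ∑ j, ∑ k, (p j * Q j k - p j * ∑ j', p j' * Q j' k) = 0 := by
    simp only [Finset.sum_sub_distrib, ← Finset.mul_sum]
    have := hm.2
    simp only at this
    simp [(hQ _).2, this]
  rw [← h1]
  unfold mutualInfo
  refine Finset.sum_le_sum fun j _ => Finset.sum_le_sum fun k _ => ?_
  by_cases h : p j * Q j k = 0
  · rw [h]
    have := mul_nonneg (hp.1 j) (hm.1 k)
    simp only at this
    linarith
  · have hq := marg_pos hp hQ h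
    have hp' : 0 < p j := lt_of_le_of_ne (hp.1 j) (Ne.symm (left_ne_zero_of_mul h))
    have hQ' : 0 < Q j k := lt_of_le_of_ne ((hQ j).1 k) (Ne.symm (right_ne_zero_of_mul h))
    have hl := Real.one_sub_inv_le_log_of_pos (div_pos hQ' hq)
    have := mul_le_mul_of_nonneg_left hl (mul_pos hp' hQ').le
    refine le_trans (le_of_eq ?_) this
    field_simp

/-- Every sequence has a zero-distortion reproduction. -/
theorem exists_zero_dist [Fintype A] [Fintype B] {ρmax : ℝ} {ρ : A → B → ℝ}
    (hρ : IsDistMeasure ρmax ρ) : ∃ z : A → B, ∀ j, ρ j (z j) = 0 :=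
  ⟨fun j => (hρ.2 j).choose, fun j => (hρ.2 j).choose_spec⟩

theorem sum_pairs {m : ℕ} [Fintype A] [Fintype B] (F : (Fin m → A × B) → ℝ) :
    ∑ z, F z = ∑ x : Fin m → A, ∑ y : Fin m → B, F (fun i => (x i, y i)) := by
  rw [← (Equiv.arrowProdEquivProdArrow (Fin m) (fun _ => A) (fun _ => B)).symm.sum_comp,
    Fintype.sum_prod_type]
  rfl

open Classical in
/-- Probability of atypical pairs. -/
theorem atypical [Fintype A] [Fintype B] {p : A → ℝ} {Q : A → B → ℝ} (hp : IsProb p)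
    (hQ : IsCondProb Q) (ρ : A → B → ℝ) (δ : ℝ) (hδ : 0 < δ) :
    ∃ V : ℝ, ∀ m : ℕ, 0 < m →
      ∑ x : Fin m → A, ∑ y : Fin m → B, prodProb p x * (∏ i, Q (x i) (y i)) *
        (if ∑ i, ρ (x i) (y i) ≤ m * (avgDist p Q ρ + δ) ∧
          Real.exp (-(m * (mutualInfo p Q + δ))) * (∏ i, Q (x i) (y i)) ≤
            ∏ i, ∑ j, p j * Q j (y i) then (0:ℝ) else 1) ≤ V / m := by
  set r : A × B → ℝ := fun z => p z.1 * Q z.1 z.2 with hr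
  have hr0 : ∀ z, 0 ≤ r z := fun z => mul_nonneg (hp.1 _) ((hQ _).1 _)
  have hr1 : ∑ z, r z = 1 := by
    rw [Fintype.sum_prod_type]
    simp only [hr, ← Finset.mul_sum, (hQ _).2, mul_one, hp.2]
  set h1 : A × B → ℝ := fun z => ρ z.1 z.2 with hh1
  set h2 : A × B → ℝ := fun z => Real.log (Q z.1 z.2 / ∑ j', p j' * Q j' z.2) with hh2
  have e1 : ∑ z, r z * h1 z = avgDist p Q ρ := by
    rw [Fintype.sum_prod_type]; rfl
  have e2 : ∑ z, r z * h2 z = mutualInfo p Q := by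
    rw [Fintype.sum_prod_type]; rfl
  refine ⟨(∑ z, r z * (h1 z - ∑ z, r z * h1 z)^2) / δ^2 +
    (∑ z, r z * (h2 z - ∑ z, r z * h2 z)^2) / δ^2, fun m hm => ?_⟩
  have c1 := iid_cheb r hr0 hr1 h1 δ hδ m hm
  have c2 := iid_cheb r hr0 hr1 h2 δ hδ m hm
  rw [add_div]
  refine le_trans ?_ (add_le_add c1 c2)
  rw [e1, e2, ← Finset.sum_add_distrib, sum_pairs]
  refine Finset.sum_le_sum fun x _ => Finset.sum_le_sum fun y _ => ?_
  have er : ∏ i, r (x i, y i) = prodProb p x * ∏ i, Q (x i) (y i) := by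
    simp only [hr, prodProb, Finset.prod_mul_distrib]
  rw [er, ← mul_add]
  have hP0 : 0 ≤ prodProb p x * ∏ i, Q (x i) (y i) := by
    rw [← er]; exact Finset.prod_nonneg fun i _ => hr0 _
  rcases hP0.eq_or_lt with h0 | hP
  · rw [← h0]; simp
  apply mul_le_mul_of_nonneg_left _ hP0
  by_cases g1 : ∑ i, ρ (x i) (y i) ≤ m * (avgDist p Q ρ + δ)
  · by_cases g2 : ∑ i, h2 (x i, y i) ≤ m * (mutualInfo p Q + δ)
    · have g3 : Real.exp (-(m * (mutualInfo p Q + δ))) * (∏ i, Q (x i) (y i)) ≤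
            ∏ i, ∑ j, p j * Q j (y i) := by
        have hne : ∀ i, p (x i) * Q (x i) (y i) ≠ 0 := by
          intro i hi
          rw [← er] at hP
          exact hP.ne' (Finset.prod_eq_zero (Finset.mem_univ i) hi)
        have hq : ∀ i, 0 < ∑ j, p j * Q j (y i) := fun i => marg_pos hp hQ (hne i)
        have hQp : ∀ i, 0 < Q (x i) (y i) := fun i =>
          lt_of_le_of_ne ((hQ _).1 _) (Ne.symm (right_ne_zero_of_mul (hne i)))
        have hexp : Real.exp (∑ i, h2 (x i, y i)) =
            (∏ i, Q (x i) (y i)) / ∏ i, ∑ j, p j * Q j (y i) := by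
          rw [Real.exp_sum, ← Finset.prod_div_distrib]
          refine Finset.prod_congr rfl fun i _ => ?_
          rw [hh2, Real.exp_log (div_pos (hQp i) (hq i))]
        have hq' : 0 < ∏ i, ∑ j, p j * Q j (y i) := Finset.prod_pos fun i _ => hq i
        have := Real.exp_le_exp.2 g2
        rw [hexp, div_le_iff₀ hq'] at this
        rw [Real.exp_neg, inv_mul_le_iff₀ (Real.exp_pos _)]
        exact this
      rw [if_pos ⟨g1, g3⟩]
      positivity
    · rw [if_pos (not_le.1 g2)]
      have : (0:ℝ) ≤ (if m * (avgDist p Q ρ + δ) < ∑ i, h1 (x i, y i) then (1:ℝ) else 0) := by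
        split_ifs <;> norm_num
      split_ifs <;> linarith
  · rw [if_neg (fun h => g1 h.1), if_pos (not_le.1 g1)]
    have : (0:ℝ) ≤ (if m * (mutualInfo p Q + δ) < ∑ i, h2 (x i, y i) then (1:ℝ) else 0) := by
        split_ifs <;> norm_num
    linarith

theorem prodProb_sum [Fintype A] {p : A → ℝ} (hp : IsProb p) (m : ℕ) :
    ∑ x : Fin m → A, prodProb p x = 1 := sum_prod_eq_one p hp.2 m

theorem prodProb_nonneg [Fintype A] {p : A → ℝ} (hp : IsProb p) {m : ℕ} (x : Fin m → A) :
    0 ≤ prodProb p x := Finset.prod_nonneg fun _ _ => hp.1 _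

open Classical in
/-- Single-source achievability. -/
theorem base_code [Fintype A] [Fintype B] [Nonempty B] {p : A → ℝ} {Q : A → B → ℝ}
    (hp : IsProb p) (hQ : IsCondProb Q) {ρmax : ℝ} {ρ : A → B → ℝ} (hρ : IsDistMeasure ρmax ρ)
    (δ : ℝ) (hδ : 0 < δ) :
    ∃ (m : ℕ) (W : (Fin m → B) → ℝ) (ψ : (Fin m → A) → (Fin m → B)), 0 < m ∧
      (∀ y, 0 < W y) ∧ ∑ y, W y ≤ 1 ∧
      (∀ x, ∑ i, ρ (x i) (ψ x i) ≤ m * (avgDist p Q ρ + δ)) ∧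
      ∑ x, prodProb p x * (-Real.log (W (ψ x))) < m * (mutualInfo p Q + 4 * δ) := by
  obtain ⟨V, hV⟩ := atypical hp hQ ρ δ hδ
  obtain ⟨z0, hz0⟩ := exists_zero_dist hρ
  set I := mutualInfo p Q with hI
  have hI0 : 0 ≤ I := mutualInfo_nonneg hp hQ
  obtain ⟨K, hK⟩ : ∃ K : ℝ, K = ((Fintype.card B : ℕ) : ℝ) := ⟨_, rfl⟩
  have hK1 : 1 ≤ K := by
    rw [hK]; exact_mod_cast Fintype.card_pos
  have hlK : 0 ≤ Real.log K := Real.log_nonneg hK1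
  -- choose m
  have hlim : Tendsto (fun m : ℕ => (2 * Real.log 2) / (m:ℝ) +
      (V / m + Real.exp (-Real.exp (m * δ))) * Real.log K) atTop (nhds 0) := by
    have t1 : Tendsto (fun m : ℕ => (2 * Real.log 2) / (m:ℝ)) atTop (nhds 0) :=
      tendsto_const_div_atTop_nhds_zero_nat _
    have t2 : Tendsto (fun m : ℕ => V / (m:ℝ)) atTop (nhds 0) :=
      tendsto_const_div_atTop_nhds_zero_nat _
    have t3 : Tendsto (fun m : ℕ => Real.exp (-Real.exp (m * δ))) atTop (nhds 0) := by
      apply Real.tendsto_exp_neg_atTop_nhds_zero.comp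
      apply Real.tendsto_exp_atTop.comp
      exact tendsto_natCast_atTop_atTop.atTop_mul_const hδ
    simpa using t1.add ((t2.add t3).mul_const (Real.log K))
  obtain ⟨m, hm1, hm2⟩ := ((hlim.eventually (gt_mem_nhds (show (0:ℝ) < δ from hδ))).and
    (eventually_gt_atTop 0)).exists
  have hmR : (0:ℝ) < m := by exact_mod_cast hm2
  set q : (Fin m → B) → ℝ := fun y => ∏ i, ∑ j, p j * Q j (y i) with hq
  have hmarg := marg_prob hp hQ
  have hq0 : ∀ y, 0 ≤ q y := fun y => Finset.prod_nonneg fun i _ => hmarg.1 _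
  have hq1 : ∑ y, q y = 1 := sum_prod_eq_one (fun k => ∑ j, p j * Q j k) hmarg.2 m
  set a := Real.exp (-(m * (I + δ))) with ha
  set N := ⌈Real.exp (m * (I + 2 * δ))⌉₊ with hN
  have hN1 : Real.exp (m * (I + 2 * δ)) ≤ N := Nat.le_ceil _
  have hN2 : (N:ℝ) ≤ 2 * Real.exp (m * (I + 2 * δ)) := by
    have h1 := (Nat.ceil_lt_add_one (Real.exp_pos (m * (I + 2 * δ))).le).le
    have h2 : 1 ≤ Real.exp (m * (I + 2 * δ)) := Real.one_le_exp (by positivity)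
    rw [← hN] at h1
    linarith
  have hNpos : (0:ℝ) < N := lt_of_lt_of_le (Real.exp_pos _) hN1
  obtain ⟨c, hc⟩ := covering (fun x : Fin m → A => prodProb p x) (prodProb_nonneg hp)
    (prodProb_sum hp m) (fun x y => ∏ i, Q (x i) (y i))
    (fun x y => Finset.prod_nonneg fun i _ => (hQ _).1 _)
    (fun x => by
      have := Finset.prod_univ_sum (fun _ : Fin m => (Finset.univ : Finset B))
        (fun i k => Q (x i) k)
      rw [Fintype.piFinset_univ] at this
      rw [← this]
      exact Finset.prod_eq_one fun i _ => (hQ _).2)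
    q hq0 hq1 (fun x y => ∑ i, ρ (x i) (y i) ≤ m * (avgDist p Q ρ + δ)) a N
  have hc2 := hc.trans (add_le_add_left (hV m hm2) _)
  have hNa : Real.exp (m * δ) ≤ N * a := by
    have : Real.exp (m * δ) = Real.exp (m * (I + 2 * δ)) * a := by
      rw [ha, ← Real.exp_add]; congr 1; ring
    rw [this]
    exact mul_le_mul_of_nonneg_right hN1 (Real.exp_pos _).le
  have hc3 := hc2.trans (add_le_add_right (Real.exp_le_exp.2 (neg_le_neg hNa)) _)
  set U : (Fin m → A) → Prop := fun x =>
    ∀ i, ¬ ∑ l, ρ (x l) (c i l) ≤ m * (avgDist p Q ρ + δ) with hU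
  have hex : ∀ x, ∃ y : Fin m → B, ∑ i, ρ (x i) (y i) ≤ m * (avgDist p Q ρ + δ) ∧
      (¬ U x → ∃ i, c i = y) := by
    intro x
    by_cases hx : U x
    · refine ⟨fun i => z0 (x i), ?_, fun h => absurd hx h⟩
      simp only [hz0, Finset.sum_const_zero]
      have : 0 ≤ avgDist p Q ρ := Finset.sum_nonneg fun j _ => Finset.sum_nonneg fun k _ =>
        mul_nonneg (mul_nonneg (hp.1 _) ((hQ _).1 _)) (hρ.1 _ _).1
      positivity
    · have hx' := hx
      simp only [hU] at hx'
      push Not at hx'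
      obtain ⟨i, hi⟩ := hx'
      exact ⟨c i, hi, fun _ => ⟨i, rfl⟩⟩
  choose ψ hψ1 hψ2 using hex
  set W : (Fin m → B) → ℝ := fun y =>
    (∑ i, if c i = y then (1:ℝ) else 0) / (2 * N) + 1 / (2 * K^m) with hW
  have hKm : 0 < K^m := by positivity
  have hWa : ∀ y, 1 / (2 * K^m) ≤ W y := by
    intro y
    have : (0:ℝ) ≤ (∑ i, if c i = y then (1:ℝ) else 0) / (2 * N) := by positivity
    simp only [hW]; linarith
  have hWb : ∀ i, 1 / (2 * (N:ℝ)) ≤ W (c i) := by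
    intro i
    have h1 : (1:ℝ) ≤ ∑ i', if c i' = c i then (1:ℝ) else 0 := by
      have := Finset.single_le_sum (f := fun i' => if c i' = c i then (1:ℝ) else 0)
        (fun i' _ => by split_ifs <;> norm_num) (Finset.mem_univ i)
      simpa using this
    have h2 : 1 / (2 * (N:ℝ)) ≤ (∑ i', if c i' = c i then (1:ℝ) else 0) / (2 * N) :=
      div_le_div_of_nonneg_right h1 (by positivity)
    have h3 : 0 < 1 / (2 * K^m) := by positivity
    simp only [hW]; linarith
  have hWpos : ∀ y, 0 < W y := fun y => lt_of_lt_of_le (by positivity) (hWa y)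
  refine ⟨m, W, ψ, hm2, hWpos, ?_, hψ1, ?_⟩
  · simp only [hW, Finset.sum_add_distrib]
    rw [← Finset.sum_div, Finset.sum_comm]
    simp only [Finset.sum_ite_eq, Finset.mem_univ, if_true, Finset.sum_const, Finset.card_univ,
      Fintype.card_fin, nsmul_eq_mul, mul_one, Fintype.card_fun]
    push_cast
    rw [← hK]
    have : (N:ℝ) / (2 * N) + K^m * (1 / (2 * K^m)) = 1 := by field_simp; norm_num
    exact this.le
  · have hcost : ∀ x, -Real.log (W (ψ x)) ≤ 2 * Real.log 2 + m * (I + 2 * δ) +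
        (if U x then (1:ℝ) else 0) * (m * Real.log K) := by
      intro x
      have hl2 : 0 < Real.log 2 := Real.log_pos (by norm_num)
      split_ifs with hx
      · have h1 := Real.log_le_log (by positivity) (hWa (ψ x))
        rw [one_div, Real.log_inv, Real.log_mul (by norm_num) hKm.ne', Real.log_pow] at h1
        have : 0 ≤ m * (I + 2 * δ) := by positivity
        linarith
      · obtain ⟨i, hi⟩ := hψ2 x hx
        have h1 := Real.log_le_log (by positivity) (hWb i)
        rw [hi, one_div, Real.log_inv, Real.log_mul (by norm_num) hNpos.ne'] at h1
        have h2 := Real.log_le_log hNpos hN2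
        rw [Real.log_mul (by norm_num) (Real.exp_pos _).ne', Real.log_exp] at h2
        linarith
    have h1 : ∑ x, prodProb p x * (-Real.log (W (ψ x))) ≤
        2 * Real.log 2 + m * (I + 2 * δ) +
          (∑ x, prodProb p x * (if U x then (1:ℝ) else 0)) * (m * Real.log K) := by
      calc _ ≤ ∑ x, prodProb p x * (2 * Real.log 2 + m * (I + 2 * δ) +
          (if U x then (1:ℝ) else 0) * (m * Real.log K)) :=
            Finset.sum_le_sum fun x _ => mul_le_mul_of_nonneg_left (hcost x) (prodProb_nonneg hp x)
        _ = _ := by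
          simp only [mul_add (prodProb p _), Finset.sum_add_distrib, ← Finset.sum_mul,
            prodProb_sum hp, one_mul, ← mul_assoc]
    have h2 : (∑ x, prodProb p x * (if U x then (1:ℝ) else 0)) * (m * Real.log K) ≤
        (V / m + Real.exp (-Real.exp (m * δ))) * (m * Real.log K) :=
      mul_le_mul_of_nonneg_right hc3 (by positivity)
    have h3 := mul_lt_mul_of_pos_left hm1 hmR
    have h4 : (m:ℝ) * ((2 * Real.log 2) / (m:ℝ) +
      (V / m + Real.exp (-Real.exp (m * δ))) * Real.log K) = 2 * Real.log 2 +
      (V / m + Real.exp (-Real.exp (m * δ))) * (m * Real.log K) := by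
      field_simp
    rw [h4] at h3
    nlinarith


open Classical in
theorem base_code_mixed [Fintype A] [Fintype B] [Nonempty B] {p : A → ℝ} {Q : A → B → ℝ}
    (hp : IsProb p) (hQ : IsCondProb Q) {ρmax : ℝ} {ρ : A → B → ℝ} (hρ : IsDistMeasure ρmax ρ)
    {d : ℝ} (hd : 0 < d) (hdist : avgDist p Q ρ ≤ d) (ε : ℝ) (hε : 0 < ε) :
    ∃ (m : ℕ) (W : (Fin m → B) → ℝ) (ψ : (Fin m → A) → (Fin m → B)) (η : ℝ), 0 < m ∧ 0 < η ∧
      (∀ y, 0 < W y) ∧ ∑ y, W y ≤ 1 ∧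
      (∀ x, ∑ i, ρ (x i) (ψ x i) ≤ m * (d - η)) ∧
      ∑ x, prodProb p x * (-Real.log (W (ψ x))) < m * (mi' p Q + ε) := by
  obtain ⟨z0, hz0⟩ := exists_zero_dist hρ
  set Ql : ℝ → A → B → ℝ := fun l j k => (1 - l) * Q j k + l * (if k = z0 j then 1 else 0) with hQl
  have hcont : Continuous (fun l : ℝ => mi' p (Ql l)) := by
    apply continuous_mi'.comp (f := fun l : ℝ => (p, Ql l))
    simp only [hQl]
    fun_prop
  have hQl0 : Ql 0 = Q := by funext j k; simp [hQl]
  have hev : ∀ᶠ l in nhds (0:ℝ), mi' p (Ql l) < mi' p Q + ε / 2 := by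
    have := hcont.tendsto 0
    rw [hQl0] at this
    exact this.eventually (gt_mem_nhds (by linarith))
  obtain ⟨l, ⟨hl1, hl2⟩, hl0⟩ := (((hev.and (gt_mem_nhds (show (0:ℝ) < 1 by norm_num))).filter_mono
    nhdsWithin_le_nhds).and (self_mem_nhdsWithin (s := Set.Ioi (0:ℝ)))).exists
  replace hl0 : 0 < l := hl0
  have hQlp : IsCondProb (Ql l) := by
    intro j
    refine ⟨fun k => ?_, ?_⟩
    · have := (hQ j).1 k
      have h1 : 0 ≤ 1 - l := by linarith
      simp only [hQl]
      positivity
    · simp only [hQl, Finset.sum_add_distrib, ← Finset.mul_sum, (hQ j).2]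
      simp
  have hav : avgDist p (Ql l) ρ = (1 - l) * avgDist p Q ρ := by
    unfold avgDist
    rw [Finset.mul_sum]
    refine Finset.sum_congr rfl fun j _ => ?_
    rw [Finset.mul_sum]
    refine Finset.sum_congr rfl fun k _ => ?_
    simp only [hQl]
    split_ifs with h
    · rw [h, hz0]; ring
    · ring
  have hδ : 0 < min (l * d / 2) (ε / 8) := lt_min (by positivity) (by positivity)
  obtain ⟨m, W, ψ, hm, hW0, hW1, hψ, hc⟩ := base_code hp hQlp hρ _ hδ
  have hmR : (0:ℝ) < m := by exact_mod_cast hm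
  refine ⟨m, W, ψ, l * d / 2, hm, by positivity, hW0, hW1, fun x => (hψ x).trans ?_, hc.trans_le ?_⟩
  · apply mul_le_mul_of_nonneg_left _ hmR.le
    rw [hav]
    have h1 := mul_le_mul_of_nonneg_left hdist (show 0 ≤ 1 - l by linarith)
    have h2 := min_le_left (l * d / 2) (ε / 8)
    linarith
  · apply mul_le_mul_of_nonneg_left _ hmR.le
    rw [mutualInfo_eq hp hQlp]
    have h2 := min_le_right (l * d / 2) (ε / 8)
    linarith

/-- `W` achieves per-source cost `c` at distortion measure `ρ`, level `d`. -/
def Good [Fintype A] (d : ℝ) {n : ℕ} (W : (Fin n → B) → ℝ) (ρ : A → B → ℝ)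
    (c : (A → ℝ) → ℝ) : Prop :=
  ∃ ψ : (Fin n → A) → (Fin n → B), (∀ x, ∑ i, ρ (x i) (ψ x i) ≤ n * d) ∧
    ∀ p, IsProb p → ∑ x, prodProb p x * (-Real.log (W (ψ x))) ≤ c p

/-- positive sub-probability -/
def IsW [Fintype B] {n : ℕ} (W : (Fin n → B) → ℝ) : Prop := (∀ y, 0 < W y) ∧ ∑ y, W y ≤ 1

theorem compact_S [Fintype A] [Fintype B] (ρmax d : ℝ) :
    IsCompact {z : (A → ℝ) × (A → B → ℝ) × (A → B → ℝ) | IsProb z.1 ∧ IsCondProb z.2.1 ∧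
      IsDistMeasure ρmax z.2.2 ∧ avgDist z.1 z.2.1 z.2.2 ≤ d} := by
  refine IsCompact.of_isClosed_subset (isCompact_Icc (a := ((fun _ => 0, fun _ _ => 0, fun _ _ => 0) :
    (A → ℝ) × (A → B → ℝ) × (A → B → ℝ))) (b := (fun _ => 1, fun _ _ => 1, fun _ _ => ρmax))) ?_ ?_
  · have c1 : IsClosed {z : (A → ℝ) × (A → B → ℝ) × (A → B → ℝ) | IsProb z.1} := by
      simp only [IsProb, Set.ofPred_and, Set.ofPred_forall]
      refine IsClosed.inter (isClosed_iInter fun j => isClosed_le (by fun_prop) (by fun_prop))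
        (isClosed_eq (by fun_prop) (by fun_prop))
    have c2 : IsClosed {z : (A → ℝ) × (A → B → ℝ) × (A → B → ℝ) | IsCondProb z.2.1} := by
      simp only [IsCondProb, IsProb, Set.ofPred_and, Set.ofPred_forall]
      refine isClosed_iInter fun j => IsClosed.inter
        (isClosed_iInter fun j => isClosed_le (by fun_prop) (by fun_prop))
        (isClosed_eq (by fun_prop) (by fun_prop))
    have c3 : IsClosed {z : (A → ℝ) × (A → B → ℝ) × (A → B → ℝ) | IsDistMeasure ρmax z.2.2} := by
      simp only [IsDistMeasure, Set.ofPred_and, Set.ofPred_forall, Set.ofPred_exists]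
      refine IsClosed.inter (isClosed_iInter fun j => isClosed_iInter fun k => IsClosed.inter
        (isClosed_le (by fun_prop) (by fun_prop)) (isClosed_le (by fun_prop) (by fun_prop)))
        (isClosed_iInter fun j => isClosed_iUnion_of_finite fun k =>
          isClosed_eq (by fun_prop) (by fun_prop))
    have c4 : IsClosed {z : (A → ℝ) × (A → B → ℝ) × (A → B → ℝ) |
        avgDist z.1 z.2.1 z.2.2 ≤ d} := by
      unfold avgDist
      exact isClosed_le (by fun_prop) (by fun_prop)
    exact c1.inter (c2.inter (c3.inter c4))
  · rintro ⟨p, Q, ρ⟩ ⟨hp, hQ, hρ, -⟩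
    have aux : ∀ {C : Type _} [Fintype C] (r : C → ℝ), IsProb r → ∀ a, r a ≤ 1 := by
      intro C _ r hr a
      rw [← hr.2]
      exact Finset.single_le_sum (fun b _ => hr.1 b) (Finset.mem_univ a)
    have aux' : ∀ {C : Type _} [Fintype C] (r : C → ℝ), IsProb r → ∀ a, r a ≤ 1 := by
      intro C _ r hr a
      rw [← hr.2]
      exact Finset.single_le_sum (fun b _ => hr.1 b) (Finset.mem_univ a)
    exact ⟨⟨fun j => hp.1 j, fun j k => (hQ j).1 k, fun j k => (hρ.1 j k).1⟩,
      ⟨fun j => aux p hp j, fun j k => aux' (Q j) (hQ j) k, fun j k => (hρ.1 j k).2⟩⟩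

theorem finite_cover {A B : Type} [Fintype A] [Fintype B] [Nonempty B] (ρmax d : ℝ) (hd : 0 < d)
    (ε : ℝ) (hε : 0 < ε) :
    ∃ (ι : Type) (_ : Fintype ι) (m : ι → ℕ) (W : (i : ι) → (Fin (m i) → B) → ℝ)
      (c : ι → (A → ℝ) → ℝ), (∀ i, 0 < m i ∧ IsW (W i)) ∧
      ∀ (p : A → ℝ) (Q ρ : A → B → ℝ), IsProb p → IsCondProb Q → IsDistMeasure ρmax ρ →
        avgDist p Q ρ ≤ d → ∃ i, Good d (W i) ρ (c i) ∧ c i p ≤ m i * (mutualInfo p Q + ε) := by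
  set S := {z : (A → ℝ) × (A → B → ℝ) × (A → B → ℝ) | IsProb z.1 ∧ IsCondProb z.2.1 ∧
      IsDistMeasure ρmax z.2.2 ∧ avgDist z.1 z.2.1 z.2.2 ≤ d} with hS
  have hb : ∀ z : S, _ := fun z =>
    base_code_mixed z.2.1 z.2.2.1 z.2.2.2.1 hd z.2.2.2.2 ε hε
  choose m W ψ η hm hη hW0 hW1 hψ hc using hb
  set c : S → (A → ℝ) → ℝ := fun s p => ∑ x, prodProb p x * (-Real.log (W s (ψ s x))) with hcdef
  have hccont : ∀ s, Continuous (c s) := by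
    intro s
    simp only [hcdef, prodProb]
    fun_prop
  obtain ⟨t, ht⟩ := (compact_S (A := A) (B := B) ρmax d).elim_nhds_subcover'
    (fun z hz => {z' | c ⟨z, hz⟩ z'.1 < m ⟨z, hz⟩ * (mi' z'.1 z'.2.1 + ε) ∧
      ∀ j k, z'.2.2 j k < z.2.2 j k + η ⟨z, hz⟩}) (by
      intro z hz
      apply IsOpen.mem_nhds
      · have hmi : Continuous (fun z : (A → ℝ) × (A → B → ℝ) × (A → B → ℝ) => mi' z.1 z.2.1) :=
          continuous_mi'.comp (f := fun z : (A → ℝ) × (A → B → ℝ) × (A → B → ℝ) => (z.1, z.2.1))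
            (by fun_prop)
        simp only [Set.ofPred_and, Set.ofPred_forall]
        refine IsOpen.inter (isOpen_lt ((hccont _).comp continuous_fst) (by fun_prop)) ?_
        refine isOpen_iInter_of_finite fun j => isOpen_iInter_of_finite fun k => ?_
        exact isOpen_lt (by fun_prop) (by fun_prop)
      · refine ⟨hc ⟨z, hz⟩, fun j k => ?_⟩
        have := hη ⟨z, hz⟩
        linarith)
  refine ⟨t, inferInstance, fun i => m i, fun i => W i, fun i => c i,
    fun i => ⟨hm i, hW0 i, hW1 i⟩, ?_⟩
  intro p Q ρ hp hQ hρ hdist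
  have hmem := ht (show (p, Q, ρ) ∈ S from ⟨hp, hQ, hρ, hdist⟩)
  simp only [Set.mem_iUnion] at hmem
  obtain ⟨s, hst, h1, h2⟩ := hmem
  refine ⟨⟨s, hst⟩, ⟨ψ s, fun x => ?_, fun p _ => le_rfl⟩, ?_⟩
  · calc ∑ i, ρ (x i) (ψ s x i) ≤ ∑ i, ((s:(A → ℝ) × (A → B → ℝ) × (A → B → ℝ)).2.2 (x i) (ψ s x i)
          + η s) := Finset.sum_le_sum fun i _ => (h2 _ _).le
      _ ≤ m s * (d - η s) + m s * η s := by
          rw [Finset.sum_add_distrib]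
          simp only [Finset.sum_const, Finset.card_univ, Fintype.card_fin, nsmul_eq_mul]
          have := hψ s x
          linarith
      _ = m s * d := by ring
  · rw [mutualInfo_eq hp hQ]
    exact h1.le

theorem sum_append {C : Type*} [Fintype C] (n1 n2 : ℕ) (F : (Fin (n1 + n2) → C) → ℝ) :
    ∑ x, F x = ∑ x1 : Fin n1 → C, ∑ x2 : Fin n2 → C, F (Fin.append x1 x2) := by
  rw [← (Fin.appendEquiv n1 n2).sum_comp, Fintype.sum_prod_type]
  rfl

theorem good_append [Fintype A] [Fintype B] {d : ℝ} {n1 n2 : ℕ} {W1 : (Fin n1 → B) → ℝ}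
    {W2 : (Fin n2 → B) → ℝ} (h1 : IsW W1) (h2 : IsW W2) :
    ∃ W : (Fin (n1 + n2) → B) → ℝ, IsW W ∧ ∀ (ρ : A → B → ℝ) c1 c2, Good d W1 ρ c1 →
      Good d W2 ρ c2 → Good d W ρ (fun p => c1 p + c2 p) := by
  refine ⟨fun y => W1 (fun i => y (Fin.castAdd n2 i)) * W2 (fun i => y (Fin.natAdd n1 i)),
    ⟨fun y => mul_pos (h1.1 _) (h2.1 _), ?_⟩, ?_⟩
  · rw [sum_append]
    simp only [Fin.append_left, Fin.append_right, ← Finset.mul_sum, ← Finset.sum_mul]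
    have := Finset.sum_nonneg (fun y (_ : y ∈ Finset.univ) => (h2.1 y).le)
    exact mul_le_one₀ h1.2 this h2.2
  · rintro ρ c1 c2 ⟨ψ1, a1, b1⟩ ⟨ψ2, a2, b2⟩
    refine ⟨fun x => Fin.append (ψ1 fun i => x (Fin.castAdd n2 i)) (ψ2 fun i => x (Fin.natAdd n1 i)),
      fun x => ?_, fun p hp => ?_⟩
    · rw [Fin.sum_univ_add]
      simp only [Fin.append_left, Fin.append_right]
      have e1 := a1 (fun i => x (Fin.castAdd n2 i))
      have e2 := a2 (fun i => x (Fin.natAdd n1 i))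
      push_cast
      linarith
    · rw [sum_append]
      simp only [Fin.append_left, Fin.append_right]
      refine le_trans (le_of_eq ?_) (add_le_add (b1 p hp) (b2 p hp))
      have e : ∀ (x1 : Fin n1 → A) (x2 : Fin n2 → A),
          prodProb p (Fin.append x1 x2) * -Real.log (W1 (ψ1 x1) * W2 (ψ2 x2)) =
          prodProb p x1 * (-Real.log (W1 (ψ1 x1))) * prodProb p x2 +
          prodProb p x1 * (prodProb p x2 * (-Real.log (W2 (ψ2 x2)))) := by
        intro x1 x2
        have : prodProb p (Fin.append x1 x2) = prodProb p x1 * prodProb p x2 := by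
          simp only [prodProb, Fin.prod_univ_add, Fin.append_left, Fin.append_right]
        rw [this, Real.log_mul (h1.1 _).ne' (h2.1 _).ne']
        ring
      simp only [e, Finset.sum_add_distrib, ← Finset.mul_sum, ← Finset.sum_mul, prodProb_sum hp,
        mul_one, one_mul]

theorem good_uniform [Fintype A] [Fintype B] [Nonempty B] {d : ℝ} (hd : 0 < d) (n : ℕ) :
    ∃ W : (Fin n → B) → ℝ, IsW W ∧ ∀ (ρmax : ℝ) (ρ : A → B → ℝ), IsDistMeasure ρmax ρ →
      Good d W ρ (fun _ => n * Real.log (Fintype.card B)) := by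
  have hK : (0:ℝ) < (Fintype.card B : ℕ) := by exact_mod_cast Fintype.card_pos
  refine ⟨fun _ => 1 / ((Fintype.card B : ℕ) : ℝ)^n, ⟨fun y => by positivity, ?_⟩, ?_⟩
  · simp only [Finset.sum_const, Finset.card_univ, Fintype.card_fun, Fintype.card_fin, nsmul_eq_mul]
    push_cast
    rw [mul_one_div_cancel (by positivity)]
  · intro ρmax ρ hρ
    obtain ⟨z0, hz0⟩ := exists_zero_dist hρ
    refine ⟨fun x i => z0 (x i), fun x => ?_, fun p hp => ?_⟩
    · simp only [hz0, Finset.sum_const_zero]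
      positivity
    · rw [← Finset.sum_mul, prodProb_sum hp, one_div, Real.log_inv, Real.log_pow]
      simp

theorem good_blocks [Fintype A] [Fintype B] [Nonempty B] {d : ℝ} (hd : 0 < d) {m : ℕ}
    {W0 : (Fin m → B) → ℝ} (h0 : IsW W0) (r t : ℕ) : ∀ n, n = r + t * m →
    ∃ W : (Fin n → B) → ℝ, IsW W ∧ ∀ (ρmax : ℝ) (ρ : A → B → ℝ) c, IsDistMeasure ρmax ρ →
      Good d W0 ρ c → Good d W ρ (fun p => r * Real.log (Fintype.card B) + t * c p) := by
  induction t with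
  | zero =>
    intro n hn
    obtain ⟨W, hW, h⟩ := good_uniform (A := A) (B := B) hd n
    refine ⟨W, hW, fun ρmax ρ c hρ _ => ?_⟩
    have := h ρmax ρ hρ
    have hnr : n = r := by simpa using hn
    subst hnr
    simpa using this
  | succ t ih =>
    intro n hn
    obtain ⟨W, hW, h⟩ := ih _ rfl
    have hn' : n = (r + t * m) + m := by rw [hn]; ring
    subst hn'
    obtain ⟨W', hW', h'⟩ := good_append (A := A) (d := d) hW h0
    refine ⟨W', hW', fun ρmax ρ c hρ hg => ?_⟩
    have := h' ρ _ _ (h ρmax ρ c hρ hg) hg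
    have e : (fun p => (r:ℝ) * Real.log (Fintype.card B) + ((t + 1 : ℕ):ℝ) * c p) =
      fun p => r * Real.log (Fintype.card B) + t * c p + c p := by
      funext p; push_cast; ring
    rw [e]; exact this

theorem universal {A B : Type} [Fintype A] [Fintype B] [Nonempty B] (ρmax d : ℝ)
    (hd : 0 < d) (ε : ℝ) (hε : 0 < ε) :
    ∃ C : ℝ, ∀ n : ℕ, ∃ L : (Fin n → B) → ℕ, (∑ y, (1/2:ℝ)^(L y) ≤ 1) ∧
      ∀ (p : A → ℝ) (Q ρ : A → B → ℝ), IsProb p → IsCondProb Q → IsDistMeasure ρmax ρ →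
        avgDist p Q ρ ≤ d → ∃ ψ : (Fin n → A) → (Fin n → B),
          (∀ x, ∑ i, ρ (x i) (ψ x i) ≤ n * d) ∧
          Real.log 2 * ∑ x, prodProb p x * (L (ψ x) : ℝ) ≤ C + n * (mutualInfo p Q + ε) := by
  obtain ⟨ι, _, m, W, c, hmW, hcov⟩ := finite_cover (A := A) (B := B) ρmax d hd ε hε
  obtain ⟨lK, hlKe⟩ : ∃ lK : ℝ, lK = Real.log ((Fintype.card B : ℕ) : ℝ) := ⟨_, rfl⟩
  have hlK : 0 ≤ lK := by
    rw [hlKe]; exact Real.log_nonneg (by exact_mod_cast Fintype.card_pos)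
  obtain ⟨M, hM⟩ : ∃ M : ℝ, M = ((Fintype.card ι : ℕ) : ℝ) := ⟨_, rfl⟩
  refine ⟨Real.log 2 + Real.log M + (∑ i, (m i : ℝ)) * lK, fun n => ?_⟩
  have hblk : ∀ i, _ := fun i => good_blocks (A := A) hd (hmW i).2 (n % m i) (n / m i) n
    (by rw [mul_comm]; exact (Nat.mod_add_div n (m i)).symm)
  choose V hV hVg using hblk
  have hl2 : 0 < Real.log 2 := Real.log_pos (by norm_num)
  by_cases hι : IsEmpty ι
  · obtain ⟨W', hW', -⟩ := good_uniform (A := A) (B := B) hd n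
    refine ⟨fun _ => 2 ^ 0 * (Fintype.card (Fin n → B)), ?_, ?_⟩
    · simp only [Finset.sum_const, Finset.card_univ, nsmul_eq_mul, pow_zero, one_mul]
      rw [one_div, inv_pow, mul_inv_le_iff₀ (by positivity), one_mul]
      exact_mod_cast Nat.lt_two_pow_self.le
    · intro p Q ρ hp hQ hρ hdist
      obtain ⟨i, -⟩ := hcov p Q ρ hp hQ hρ hdist
      exact (hι.false i).elim
  rw [not_isEmpty_iff] at hι
  have hMpos : 0 < M := by rw [hM]; exact_mod_cast Fintype.card_pos
  set U : (Fin n → B) → ℝ := fun y => ∑ i, V i y / M with hU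
  have hUge : ∀ i y, V i y / M ≤ U y := fun i y =>
    Finset.single_le_sum (f := fun i => V i y / M)
      (fun i _ => div_nonneg ((hV i).1 y).le hMpos.le) (Finset.mem_univ i)
  have hUpos : ∀ y, 0 < U y := fun y =>
    lt_of_lt_of_le (div_pos ((hV hι.some).1 y) hMpos) (hUge _ y)
  have hU1 : ∑ y, U y ≤ 1 := by
    simp only [hU]
    rw [Finset.sum_comm]
    calc ∑ i, ∑ y, V i y / M ≤ ∑ _i : ι, 1 / M := by
          refine Finset.sum_le_sum fun i _ => ?_
          rw [← Finset.sum_div]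
          exact div_le_div_of_nonneg_right (hV i).2 hMpos.le
      _ = 1 := by
          simp only [Finset.sum_const, Finset.card_univ, nsmul_eq_mul, ← hM]
          field_simp
  have hUle : ∀ y, U y ≤ 1 := fun y =>
    (Finset.single_le_sum (fun y _ => (hUpos y).le) (Finset.mem_univ y)).trans hU1
  refine ⟨fun y => ⌈-Real.log (U y) / Real.log 2⌉₊, ?_, ?_⟩
  · refine le_trans (Finset.sum_le_sum fun y _ => ?_) hU1
    have h1 := Nat.le_ceil (-Real.log (U y) / Real.log 2)
    rw [div_le_iff₀ hl2] at h1
    rw [← Real.log_le_log_iff (by positivity) (hUpos y), Real.log_pow, one_div, Real.log_inv]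
    linarith
  · intro p Q ρ hp hQ hρ hdist
    obtain ⟨i, hg, hci⟩ := hcov p Q ρ hp hQ hρ hdist
    obtain ⟨ψ, hψ1, hψ2⟩ := hVg i ρmax ρ (c i) hρ hg
    refine ⟨ψ, hψ1, ?_⟩
    have hψ3 := hψ2 p hp
    rw [← hlKe] at hψ3
    have hlen : ∀ y, Real.log 2 * ((⌈-Real.log (U y) / Real.log 2⌉₊ : ℕ) : ℝ) ≤
        (Real.log 2 + Real.log M) + -Real.log (V i y) := by
      intro y
      have h1 := (Nat.ceil_lt_add_one (a := -Real.log (U y) / Real.log 2)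
        (div_nonneg (neg_nonneg.2 (Real.log_nonpos (hUpos y).le (hUle y))) hl2.le)).le
      have h2 := mul_le_mul_of_nonneg_left h1 hl2.le
      have h3 : Real.log 2 * (-Real.log (U y) / Real.log 2 + 1) = -Real.log (U y) + Real.log 2 := by
        field_simp
      have h4 := Real.log_le_log (div_pos ((hV i).1 y) hMpos) (hUge i y)
      rw [Real.log_div ((hV i).1 y).ne' hMpos.ne'] at h4
      linarith
    have hI : 0 ≤ mutualInfo p Q + ε := add_nonneg (mutualInfo_nonneg hp hQ) hε.le
    have k1 : Real.log 2 * ∑ x, prodProb p x * ((⌈-Real.log (U (ψ x)) / Real.log 2⌉₊ : ℕ) : ℝ) ≤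
        (Real.log 2 + Real.log M) + ∑ x, prodProb p x * -Real.log (V i (ψ x)) := by
      calc _ = ∑ x, prodProb p x *
            (Real.log 2 * ((⌈-Real.log (U (ψ x)) / Real.log 2⌉₊ : ℕ) : ℝ)) := by
            rw [Finset.mul_sum]
            refine Finset.sum_congr rfl fun x _ => ?_
            ring
        _ ≤ ∑ x, prodProb p x * ((Real.log 2 + Real.log M) + -Real.log (V i (ψ x))) :=
            Finset.sum_le_sum fun x _ =>
              mul_le_mul_of_nonneg_left (hlen _) (prodProb_nonneg hp x)
        _ = _ := by
            simp only [mul_add (prodProb p _) (_ + _), Finset.sum_add_distrib, ← Finset.sum_mul,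
              prodProb_sum hp, one_mul]
    have k2 : ((n % m i : ℕ) : ℝ) * lK ≤ (∑ i, (m i : ℝ)) * lK := by
      apply mul_le_mul_of_nonneg_right _ hlK
      have e1 : ((n % m i : ℕ) : ℝ) ≤ m i := by
        exact_mod_cast (Nat.mod_lt n (hmW i).1).le
      exact e1.trans (Finset.single_le_sum (f := fun i => (m i : ℝ))
        (fun i _ => Nat.cast_nonneg _) (Finset.mem_univ i))
    have k3 : ((n / m i : ℕ) : ℝ) * c i p ≤ n * (mutualInfo p Q + ε) := by
      have e1 : ((n / m i : ℕ) : ℝ) * m i ≤ n := by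
        exact_mod_cast Nat.div_mul_le_self n (m i)
      have e2 := mul_le_mul_of_nonneg_left hci (Nat.cast_nonneg (α := ℝ) (n / m i))
      have e3 := mul_le_mul_of_nonneg_right e1 hI
      linarith
    linarith

theorem nDist_le_iff {n : ℕ} (hn : 0 < n) (ρ : A → B → ℝ) (x : Fin n → A) (y : Fin n → B) (d : ℝ) :
    nDist ρ x y ≤ d ↔ ∑ i, ρ (x i) (y i) ≤ n * d := by
  unfold nDist
  rw [div_le_iff₀ (by exact_mod_cast hn), mul_comm]

/-- Corollary 1: for fixed `d > 0`, the minimax redundancy over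
deterministic *prefix* `d`-semifaithful codes in the universal distortion setting,
`inf_{codes} sup_{p ∈ P(A), ρ ∈ D} [(ln 2/n) E_p[l(f_n(φ_n(X^n,ρ)))] − R(p,d,ρ)]`,
tends to `0` as `n → ∞`. -/
theorem minimax_prefix_universal (J K : ℕ) (hJ : 0 < J) (hK : 0 < K)
    (ρmax : ℝ) (hρmax : 0 < ρmax) (d : ℝ) (hd : 0 < d) :
    Tendsto (fun n : ℕ =>
      sInf { r : ℝ |
        ∃ (φ : (Fin n → Fin J) → (Fin J → Fin K → ℝ) → (Fin n → Fin K))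
          (f : (Fin n → Fin K) → List Bool)
          (g : List Bool → (Fin n → Fin K)),
          (∀ x ρ, IsDistMeasure ρmax ρ → nDist ρ x (φ x ρ) ≤ d) ∧
          (∀ x ρ, IsDistMeasure ρmax ρ → g (f (φ x ρ)) = φ x ρ) ∧
          (∀ x₁ ρ₁ x₂ ρ₂, IsDistMeasure ρmax ρ₁ → IsDistMeasure ρmax ρ₂ →
            f (φ x₁ ρ₁) <+: f (φ x₂ ρ₂) → f (φ x₁ ρ₁) = f (φ x₂ ρ₂)) ∧
          r = sSup { v : ℝ | ∃ (p : Fin J → ℝ) (ρ : Fin J → Fin K → ℝ),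
                IsProb p ∧ IsDistMeasure ρmax ρ ∧
                v = (Real.log 2 / n) *
                      (∑ x : Fin n → Fin J, prodProb p x * ((f (φ x ρ)).length : ℝ))
                    - RD p d ρ } })
      atTop (nhds 0) := by
  have hK' : Nonempty (Fin K) := ⟨⟨0, hK⟩⟩
  rw [Metric.tendsto_atTop]
  intro ε hε
  obtain ⟨C, hC⟩ := universal (A := Fin J) (B := Fin K) ρmax d hd (ε / 4) (by positivity)
  have hlim : Tendsto (fun n : ℕ => C / (n:ℝ)) atTop (nhds 0) :=
    tendsto_const_div_atTop_nhds_zero_nat C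
  obtain ⟨N, hN⟩ := eventually_atTop.1 ((hlim.eventually
    (gt_mem_nhds (show (0:ℝ) < ε / 4 by positivity))).and (eventually_gt_atTop 0))
  refine ⟨N, fun n hn => ?_⟩
  obtain ⟨hCn, hn0⟩ := hN n hn
  have hnR : (0:ℝ) < n := by exact_mod_cast hn0
  have hl2 : 0 < Real.log 2 := Real.log_pos (by norm_num)
  set T := {r : ℝ |
        ∃ (φ : (Fin n → Fin J) → (Fin J → Fin K → ℝ) → (Fin n → Fin K))
          (f : (Fin n → Fin K) → List Bool)
          (g : List Bool → (Fin n → Fin K)),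
          (∀ x ρ, IsDistMeasure ρmax ρ → nDist ρ x (φ x ρ) ≤ d) ∧
          (∀ x ρ, IsDistMeasure ρmax ρ → g (f (φ x ρ)) = φ x ρ) ∧
          (∀ x₁ ρ₁ x₂ ρ₂, IsDistMeasure ρmax ρ₁ → IsDistMeasure ρmax ρ₂ →
            f (φ x₁ ρ₁) <+: f (φ x₂ ρ₂) → f (φ x₁ ρ₁) = f (φ x₂ ρ₂)) ∧
          r = sSup { v : ℝ | ∃ (p : Fin J → ℝ) (ρ : Fin J → Fin K → ℝ),
                IsProb p ∧ IsDistMeasure ρmax ρ ∧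
                v = (Real.log 2 / n) *
                      (∑ x : Fin n → Fin J, prodProb p x * ((f (φ x ρ)).length : ℝ))
                    - RD p d ρ } } with hT
  -- lower bound: point masses
  have hlow : ∀ r ∈ T, 0 ≤ r := by
    rintro r ⟨φ, f, g, -, -, -, rfl⟩
    apply Real.sSup_nonneg'
    have hp : IsProb (Pi.single (⟨0, hJ⟩ : Fin J) (1:ℝ)) := by
      refine ⟨fun a => ?_, by simp⟩
      by_cases h : a = ⟨0, hJ⟩
      · subst h; simp
      · simp [h]
    have hρ0 : IsDistMeasure ρmax (fun (_ : Fin J) (_ : Fin K) => (0:ℝ)) :=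
      ⟨fun _ _ => ⟨le_rfl, hρmax.le⟩, fun _ => ⟨⟨0, hK⟩, rfl⟩⟩
    refine ⟨_, ⟨_, _, hp, hρ0, rfl⟩, ?_⟩
    have hRD : RD (Pi.single (⟨0, hJ⟩ : Fin J) (1:ℝ)) d
        (fun (_ : Fin J) (_ : Fin K) => (0:ℝ)) ≤ 0 := by
      refine Real.sInf_nonpos ?_
      rintro r ⟨Q, hQ, -, rfl⟩
      refine le_of_eq ?_
      unfold mutualInfo
      refine Finset.sum_eq_zero fun j _ => Finset.sum_eq_zero fun k _ => ?_
      by_cases h : j = ⟨0, hJ⟩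
      · subst h
        have : ∑ j', (Pi.single (⟨0, hJ⟩ : Fin J) (1:ℝ) : Fin J → ℝ) j' * Q j' k
            = Q ⟨0, hJ⟩ k := by
          rw [Finset.sum_eq_single (⟨0, hJ⟩ : Fin J)]
          · simp
          · intro b _ hb; simp [hb]
          · simp
        rw [this]
        by_cases h0 : Q ⟨0, hJ⟩ k = 0
        · simp [h0]
        · rw [div_self h0]; simp
      · simp [h]
    have hE : 0 ≤ (Real.log 2 / n) * (∑ x : Fin n → Fin J,
        prodProb (Pi.single (⟨0, hJ⟩ : Fin J) (1:ℝ)) x *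
          ((f (φ x (fun (_ : Fin J) (_ : Fin K) => (0:ℝ)))).length : ℝ)) :=
      mul_nonneg (by positivity) (Finset.sum_nonneg fun x _ =>
        mul_nonneg (prodProb_nonneg hp x) (Nat.cast_nonneg _))
    linarith
  -- the universal code
  obtain ⟨L, hL1, hL2⟩ := hC n
  obtain ⟨f, hf1, hf2⟩ := kraft_aux L Finset.univ hL1
  have hfinj : Function.Injective f := fun y z h =>
    hf2 y (Finset.mem_univ _) z (Finset.mem_univ _) (by rw [h])
  have hφ : ∀ (x : Fin n → Fin J) (ρ : Fin J → Fin K → ℝ), ∃ y : Fin n → Fin K,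
      IsDistMeasure ρmax ρ → nDist ρ x y ≤ d ∧ ∀ y', nDist ρ x y' ≤ d → L y ≤ L y' := by
    intro x ρ
    by_cases hρ : IsDistMeasure ρmax ρ
    · obtain ⟨z0, hz0⟩ := exists_zero_dist hρ
      classical
      obtain ⟨y, hy1, hy2⟩ := Finset.exists_min_image
        (Finset.univ.filter fun y : Fin n → Fin K => nDist ρ x y ≤ d) L
        ⟨fun i => z0 (x i), by
          simp only [Finset.mem_filter, Finset.mem_univ, true_and]
          rw [nDist_le_iff hn0]
          simp only [hz0, Finset.sum_const_zero]
          positivity⟩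
      simp only [Finset.mem_filter, Finset.mem_univ, true_and] at hy1 hy2
      exact ⟨y, fun _ => ⟨hy1, hy2⟩⟩
    · exact ⟨fun _ => ⟨0, hK⟩, fun h => absurd h hρ⟩
  choose φ hφ using hφ
  have hmem : sSup { v : ℝ | ∃ (p : Fin J → ℝ) (ρ : Fin J → Fin K → ℝ),
                IsProb p ∧ IsDistMeasure ρmax ρ ∧
                v = (Real.log 2 / n) *
                      (∑ x : Fin n → Fin J, prodProb p x * ((f (φ x ρ)).length : ℝ))
                    - RD p d ρ } ∈ T := by
    refine ⟨φ, f, Function.invFun f, fun x ρ hρ => (hφ x ρ hρ).1,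
      fun x ρ _ => Function.leftInverse_invFun hfinj _, ?_, rfl⟩
    intro x₁ ρ₁ x₂ ρ₂ _ _ h
    rw [hf2 _ (Finset.mem_univ _) _ (Finset.mem_univ _) h]
  have hup : sInf T ≤ ε / 2 := by
    refine (csInf_le ⟨0, hlow⟩ hmem).trans (Real.sSup_le ?_ (by positivity))
    rintro v ⟨p, ρ, hp, hρ, rfl⟩
    rw [sub_le_iff_le_add, ← sub_le_iff_le_add']
    refine le_csInf ?_ ?_
    · obtain ⟨z0, hz0⟩ := exists_zero_dist hρ
      classical
      refine ⟨_, fun j k => if k = z0 j then 1 else 0, fun j => ⟨fun k => ?_, by simp⟩, ?_, rfl⟩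
      · dsimp only; split_ifs <;> norm_num
      · unfold avgDist
        refine le_of_eq_of_le (Finset.sum_eq_zero fun j _ => Finset.sum_eq_zero fun k _ => ?_) hd.le
        dsimp only; split_ifs with h
        · rw [h, hz0]; simp
        · simp
    · rintro r ⟨Q, hQ, hdist, rfl⟩
      obtain ⟨ψ, hψ1, hψ2⟩ := hL2 p Q ρ hp hQ hρ hdist
      have h1 : ∑ x : Fin n → Fin J, prodProb p x * ((f (φ x ρ)).length : ℝ) ≤
          ∑ x, prodProb p x * (L (ψ x) : ℝ) := by
        refine Finset.sum_le_sum fun x _ => mul_le_mul_of_nonneg_left ?_ (prodProb_nonneg hp x)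
        rw [hf1 _ (Finset.mem_univ _)]
        exact_mod_cast (hφ x ρ hρ).2 _ ((nDist_le_iff hn0 ρ x _ d).2 (hψ1 x))
      have h2 := (mul_le_mul_of_nonneg_left h1 hl2.le).trans hψ2
      have h3 := div_le_div_of_nonneg_right h2 hnR.le
      have h4 : (C + n * (mutualInfo p Q + ε / 4)) / n = C / n + (mutualInfo p Q + ε / 4) := by
        field_simp
      rw [h4, mul_div_right_comm] at h3
      linarith
  have hlo : 0 ≤ sInf T := Real.sInf_nonneg hlow
  rw [Real.dist_eq, sub_zero, abs_of_nonneg hlo]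
  linarith
end
end

section
/- For every fixed d > 0, lim_{n→∞} inf over deterministic (not necessarily prefix) d-semifaithful codes (φ_n, f_n, g_n) in the universal distortion setting of sup_{p ∈ P(A), ρ ∈ D} [ (ln 2 / n)·E_p[ l(f_n(φ_n(X^n, ρ))) ] − R(p,d,ρ) ] = 0. -/
open Filter MeasureTheory
open scoped BigOperators

noncomputable section

variable {A B : Type*}

lemma sum_prod_eq_one_s10 {Y : Type*} [Fintype Y] {n : ℕ} (W : Fin n → Y → ℝ)
    (hW : ∀ i, IsProb (W i)) : ∑ y : Fin n → Y, ∏ i, W i (y i) = 1 := by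
  classical
  have := Fintype.prod_sum (fun i y => W i y)
  rw [← this]
  exact Finset.prod_eq_one (fun i _ => (hW i).2)

lemma prod_nonneg' {Y : Type*} [Fintype Y] {n : ℕ} (W : Fin n → Y → ℝ)
    (hW : ∀ i, IsProb (W i)) (y : Fin n → Y) : 0 ≤ ∏ i, W i (y i) :=
  Finset.prod_nonneg (fun i _ => (hW i).1 _)

lemma second_moment {Y : Type*} [Fintype Y] (n : ℕ) : ∀ (W : Fin n → Y → ℝ)
    (_ : ∀ i, IsProb (W i)) (h : Fin n → Y → ℝ)
    (_ : ∀ i, ∑ y, W i y * h i y = 0) (_ : ∀ i y, |h i y| ≤ 1) (s : ℝ),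
    ∑ y : Fin n → Y, (∏ i, W i (y i)) * (s + ∑ i, h i (y i)) ^ 2 ≤ s ^ 2 + n := by
  induction n with
  | zero => intro W hW h h0 h1 s; simp
  | succ n ih =>
    intro W hW h h0 h1 s
    rw [← (Fin.consEquiv (fun _ => Y)).sum_comp, Fintype.sum_prod_type]
    simp only [Fin.consEquiv_apply, Fin.prod_univ_succ, Fin.sum_univ_succ, Fin.cons_zero,
      Fin.cons_succ]
    calc _ ≤ ∑ y0, W 0 y0 * ((s + h 0 y0) ^ 2 + n) := by
          refine Finset.sum_le_sum fun y0 _ => ?_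
          have := ih (fun i => W i.succ) (fun i => hW _) (fun i => h i.succ) (fun i => h0 _)
            (fun i => h1 _) (s + h 0 y0)
          have h2 := mul_le_mul_of_nonneg_left this ((hW 0).1 y0)
          refine le_trans (le_of_eq ?_) h2
          rw [Finset.mul_sum]
          refine Finset.sum_congr rfl fun y _ => ?_
          ring
      _ ≤ ∑ y0, (W 0 y0 * (s ^ 2 + 1 + n) + 2 * s * (W 0 y0 * h 0 y0)) := by
          refine Finset.sum_le_sum fun y0 _ => ?_
          have h2 : (h 0 y0) ^ 2 ≤ 1 := by
            rw [sq_le_one_iff_abs_le_one]; exact h1 _ _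
          nlinarith [mul_le_mul_of_nonneg_left h2 ((hW 0).1 y0)]
      _ = _ := by
          rw [Finset.sum_add_distrib, ← Finset.sum_mul, ← Finset.mul_sum, h0, (hW 0).2]
          push_cast; ring

lemma cheb {Y : Type*} [Fintype Y] (n : ℕ) (hn : 0 < n) (W : Fin n → Y → ℝ)
    (hW : ∀ i, IsProb (W i)) (h : Fin n → Y → ℝ)
    (h0 : ∀ i, ∑ y, W i y * h i y = 0) (h1 : ∀ i y, |h i y| ≤ 1) (δ : ℝ) (hδ : 0 < δ) :
    ∑ y : Fin n → Y, (∏ i, W i (y i)) * (if δ * n < |∑ i, h i (y i)| then (1 : ℝ) else 0)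
      ≤ 1 / (n * δ ^ 2) := by
  have h2 := second_moment n W hW h h0 h1 0
  have hn' : (0 : ℝ) < n := by exact_mod_cast hn
  rw [le_div_iff₀ (by positivity), Finset.sum_mul]
  have : ∑ y : Fin n → Y, (∏ i, W i (y i)) * (if δ * n < |∑ i, h i (y i)| then (1 : ℝ) else 0)
      * (n * δ ^ 2) * n ≤ 1 * (n : ℝ) := by
    rw [one_mul]
    refine le_trans ?_ (h2.trans (by simp))
    refine Finset.sum_le_sum fun y _ => ?_
    rw [mul_assoc, mul_assoc]
    refine mul_le_mul_of_nonneg_left ?_ (prod_nonneg' W hW y)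
    split_ifs with hh
    · have : (δ * n) ^ 2 ≤ |∑ i, h i (y i)| ^ 2 := by gcongr
      rw [sq_abs] at this
      rw [zero_add]; nlinarith
    · rw [zero_mul]; positivity
  rw [← Finset.sum_mul] at this
  exact le_of_mul_le_mul_right this hn'

lemma greedy {X Y : Type*} [Fintype X] [Fintype Y] [DecidableEq Y] (S : Finset X)
    (w : Y → ℝ) (hw : IsProb w)
    (E : X → Y → Prop) [∀ x y, Decidable (E x y)] (α : ℝ) (hα1 : α ≤ 1)
    (hE : ∀ x ∈ S, α ≤ ∑ y, w y * (if E x y then 1 else 0)) (M : ℕ) :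
    ∃ C : Finset Y, C.card ≤ M ∧
      ((S.filter fun x => ∀ y ∈ C, ¬ E x y).card : ℝ) ≤ (1 - α) ^ M * S.card := by
  induction M with
  | zero =>
    refine ⟨∅, by simp, ?_⟩
    simp
  | succ M ih =>
    obtain ⟨C, hC, hR⟩ := ih
    set R := S.filter fun x => ∀ y ∈ C, ¬ E x y with hRdef
    have key : ∃ y, α * R.card ≤ ((R.filter fun x => E x y).card : ℝ) := by
      by_contra hcon
      push Not at hcon
      have h1 : ∑ y, w y * ((R.filter fun x => E x y).card : ℝ) < α * R.card := by
        have hex : ∃ y, 0 < w y := by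
          by_contra hno
          push Not at hno
          have : ∑ y, w y ≤ 0 := Finset.sum_nonpos fun y _ => hno y
          rw [hw.2] at this; linarith
        obtain ⟨y0, hy0⟩ := hex
        calc _ < ∑ y, w y * (α * R.card) := by
              refine Finset.sum_lt_sum (fun y _ => ?_) ⟨y0, Finset.mem_univ _, ?_⟩
              · exact mul_le_mul_of_nonneg_left (hcon y).le (hw.1 y)
              · exact mul_lt_mul_of_pos_left (hcon y0) hy0
          _ = _ := by rw [← Finset.sum_mul, hw.2, one_mul]
      have h2 : α * R.card ≤ ∑ y, w y * ((R.filter fun x => E x y).card : ℝ) := by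
        calc α * R.card = ∑ x ∈ R, α := by simp [mul_comm]
          _ ≤ ∑ x ∈ R, ∑ y, w y * (if E x y then 1 else 0) :=
            Finset.sum_le_sum fun x hx => hE x (Finset.mem_filter.1 hx).1
          _ = _ := by
            rw [Finset.sum_comm]
            refine Finset.sum_congr rfl fun y _ => ?_
            rw [← Finset.mul_sum, Finset.sum_boole]
      linarith
    obtain ⟨y, hy⟩ := key
    refine ⟨insert y C, (Finset.card_insert_le _ _).trans (by omega), ?_⟩
    have h3 : (S.filter fun x => ∀ y' ∈ insert y C, ¬ E x y') = R.filter fun x => ¬ E x y := by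
      ext x
      simp only [hRdef, Finset.mem_filter, Finset.mem_insert, forall_eq_or_imp]
      tauto
    rw [h3]
    have h4 := Finset.card_filter_add_card_filter_not (s := R) (fun x => E x y)
    have h5 : ((R.filter fun x => E x y).card : ℝ) + ((R.filter fun x => ¬ E x y).card : ℝ)
      = R.card := by exact_mod_cast h4
    have h6 : (1 - α) * R.card ≤ (1 - α) * ((1 - α) ^ M * S.card) :=
      mul_le_mul_of_nonneg_left hR (by linarith)
    rw [pow_succ]; nlinarith

lemma encode {Y : Type*} [Fintype Y] [Nonempty Y] (l : Y → ℕ)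
    (hl : ∀ L, (Finset.univ.filter fun y => l y = L).card ≤ 2 ^ L) :
    ∃ (f : Y → List Bool) (g : List Bool → Y), (∀ y, g (f y) = y) ∧ ∀ y, (f y).length = l y := by
  classical
  have h : ∀ L, ∃ e : Y → (Fin L → Bool), ∀ y y', l y = L → l y' = L → e y = e y' → y = y' := by
    intro L
    have hc : Fintype.card {y // l y = L} ≤ Fintype.card (Fin L → Bool) := by
      rw [Fintype.card_subtype]; simpa using hl L
    obtain ⟨e⟩ := Function.Embedding.nonempty_of_card_le hc
    refine ⟨fun y => if h : l y = L then e ⟨y, h⟩ else fun _ => false, ?_⟩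
    intro y y' hy hy' he
    simp only [hy, hy', dif_pos] at he
    have := e.injective he
    simpa using this
  choose e he using h
  have hinj : Function.Injective (fun y => List.ofFn (e (l y) y)) := by
    intro y y' hyy
    have hlen : l y = l y' := by
      have := congrArg List.length hyy
      simpa using this
    simp only at hyy
    rw [hlen] at hyy
    exact he (l y') y y' hlen rfl (List.ofFn_injective hyy)
  exact ⟨_, Function.invFun (fun y => List.ofFn (e (l y) y)), Function.leftInverse_invFun hinj,
    fun y => by simp⟩

/-- joint counts -/
def cnt [DecidableEq A] [DecidableEq B] {n : ℕ} (x : Fin n → A) (y : Fin n → B) (j : A) (k : B) :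
    ℝ := ∑ i, if x i = j ∧ y i = k then 1 else 0

/-- counts -/
def cntA [DecidableEq A] {n : ℕ} (x : Fin n → A) (j : A) : ℝ := ∑ i, if x i = j then 1 else 0

lemma sum_cnt [Fintype A] [Fintype B] [DecidableEq A] [DecidableEq B] {n : ℕ} (x : Fin n → A)
    (y : Fin n → B) (F : A → B → ℝ) :
    ∑ i, F (x i) (y i) = ∑ j, ∑ k, cnt x y j k * F j k := by
  simp only [cnt, Finset.sum_mul]
  simp_rw [Finset.sum_comm (s := (Finset.univ : Finset B))]
  rw [Finset.sum_comm]
  refine Finset.sum_congr rfl fun i _ => ?_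
  simp [ite_and]

lemma IsProb.le_one [Fintype A] {p : A → ℝ} (hp : IsProb p) (a : A) : p a ≤ 1 := by
  rw [← hp.2]
  exact Finset.single_le_sum (fun i _ => hp.1 i) (Finset.mem_univ a)

lemma IsProb.mean_ind [Fintype A] [DecidableEq A] {p : A → ℝ} (hp : IsProb p) (a : A) :
    ∑ b, p b * ((if b = a then 1 else 0) - p a) = 0 := by
  simp only [mul_sub, Finset.sum_sub_distrib, ← Finset.sum_mul, hp.2]
  simp

lemma IsProb.abs_ind [Fintype A] [DecidableEq A] {p : A → ℝ} (hp : IsProb p) (a b : A) :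
    |(if b = a then (1 : ℝ) else 0) - p a| ≤ 1 := by
  have := hp.1 a
  have := hp.le_one a
  rw [abs_le]; split_ifs <;> constructor <;> linarith

lemma source_typ [Fintype A] [DecidableEq A] (n : ℕ) (hn : 0 < n) (p : A → ℝ) (hp : IsProb p)
    (δ : ℝ) (hδ : 0 < δ) :
    ∑ x : Fin n → A, prodProb p x * (if ∀ j, |cntA x j - n * p j| ≤ δ * n then 0 else 1)
      ≤ Fintype.card A * (1 / (n * δ ^ 2)) := by
  have h1 : ∀ j, ∑ x : Fin n → A, prodProb p x *
      (if δ * n < |cntA x j - n * p j| then (1 : ℝ) else 0) ≤ 1 / (n * δ ^ 2) := by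
    intro j
    have := cheb n hn (fun _ => p) (fun _ => hp) (fun _ b => (if b = j then 1 else 0) - p j)
      (fun _ => hp.mean_ind j) (fun _ b => hp.abs_ind j b) δ hδ
    have e : ∀ x : Fin n → A, ∑ i, ((if x i = j then (1 : ℝ) else 0) - p j)
        = cntA x j - n * p j := fun x => by
      rw [Finset.sum_sub_distrib]; simp [cntA]
    simp only [e] at this
    exact this
  calc _ ≤ ∑ x : Fin n → A, ∑ j, prodProb p x *
      (if δ * n < |cntA x j - n * p j| then (1 : ℝ) else 0) := by
        refine Finset.sum_le_sum fun x _ => ?_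
        rw [← Finset.mul_sum]
        refine mul_le_mul_of_nonneg_left ?_ (Finset.prod_nonneg fun i _ => hp.1 _)
        split_ifs with h
        · exact Finset.sum_nonneg fun j _ => by split_ifs <;> norm_num
        · push Not at h
          obtain ⟨j, hj⟩ := h
          have := Finset.single_le_sum (f := fun j =>
            (if δ * n < |cntA x j - n * p j| then (1 : ℝ) else 0))
            (fun j _ => by split_ifs <;> norm_num) (Finset.mem_univ j)
          simpa [hj] using this
    _ ≤ ∑ j : A, 1 / (n * δ ^ 2) := by
        rw [Finset.sum_comm]
        exact Finset.sum_le_sum fun j _ => h1 j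
    _ = _ := by simp

lemma cond_typ [Fintype A] [DecidableEq A] [Fintype B] [DecidableEq B] (n : ℕ) (hn : 0 < n)
    (p : A → ℝ) (Q : A → B → ℝ) (hQ : IsCondProb Q) (x : Fin n → A)
    (δ : ℝ) (hδ : 0 < δ) (hx : ∀ j, |cntA x j - n * p j| ≤ 2 * δ * n) :
    1 - Fintype.card A * Fintype.card B * (1 / (n * δ ^ 2)) ≤
    ∑ y : Fin n → B, (∏ i, Q (x i) (y i)) *
      (if ∀ j k, |cnt x y j k - n * (p j * Q j k)| ≤ 3 * δ * n then 1 else 0) := by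
  have h1 : ∀ j k, ∑ y : Fin n → B, (∏ i, Q (x i) (y i)) *
      (if δ * n < |cnt x y j k - cntA x j * Q j k| then (1 : ℝ) else 0) ≤ 1 / (n * δ ^ 2) := by
    intro j k
    have := cheb n hn (fun i => Q (x i)) (fun i => hQ _)
      (fun i b => if x i = j then ((if b = k then 1 else 0) - Q j k) else 0) ?_ ?_ δ hδ
    · convert this using 8 with y
      simp only [cnt, cntA, Finset.sum_mul, ← Finset.sum_sub_distrib]
      refine Finset.sum_congr rfl fun i _ => ?_
      by_cases h : x i = j <;> simp [h]
    · intro i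
      by_cases h : x i = j
      · simp only [h, if_true]
        exact (hQ j).mean_ind k
      · simp [h]
    · intro i b
      by_cases h : x i = j
      · simp only [h, if_true]
        exact (hQ j).abs_ind k b
      · simp [h]
  have h2 : ∑ y : Fin n → B, (∏ i, Q (x i) (y i)) *
      (1 - ∑ j, ∑ k, (if δ * n < |cnt x y j k - cntA x j * Q j k| then (1 : ℝ) else 0)) ≤
      ∑ y : Fin n → B, (∏ i, Q (x i) (y i)) *
      (if ∀ j k, |cnt x y j k - n * (p j * Q j k)| ≤ 3 * δ * n then 1 else 0) := by
    refine Finset.sum_le_sum fun y _ => mul_le_mul_of_nonneg_left ?_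
      (Finset.prod_nonneg fun i _ => (hQ _).1 _)
    split_ifs with h
    · have : 0 ≤ ∑ j, ∑ k, (if δ * n < |cnt x y j k - cntA x j * Q j k| then (1 : ℝ) else 0) :=
        Finset.sum_nonneg fun j _ => Finset.sum_nonneg fun k _ => by split_ifs <;> norm_num
      linarith
    · push Not at h
      obtain ⟨j, k, hjk⟩ := h
      have h3 : δ * n < |cnt x y j k - cntA x j * Q j k| := by
        by_contra hcon
        push Not at hcon
        have e : cnt x y j k - n * (p j * Q j k) = (cnt x y j k - cntA x j * Q j k)
          + (cntA x j - n * p j) * Q j k := by ring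
        have h4 : |(cntA x j - n * p j) * Q j k| ≤ 2 * δ * n := by
          rw [abs_mul, abs_of_nonneg ((hQ j).1 k)]
          calc _ ≤ |cntA x j - n * p j| * 1 :=
                mul_le_mul_of_nonneg_left ((hQ j).le_one k) (abs_nonneg _)
            _ ≤ _ := by rw [mul_one]; exact hx j
        rw [e] at hjk
        have := abs_add_le (cnt x y j k - cntA x j * Q j k) ((cntA x j - n * p j) * Q j k)
        linarith
      have h5 : (1 : ℝ) ≤ ∑ k, (if δ * n < |cnt x y j k - cntA x j * Q j k| then (1 : ℝ) else 0) := by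
        have := Finset.single_le_sum (f := fun k =>
            (if δ * n < |cnt x y j k - cntA x j * Q j k| then (1 : ℝ) else 0))
            (fun j _ => by split_ifs <;> norm_num) (Finset.mem_univ k)
        simpa [h3] using this
      have h6 := Finset.single_le_sum (f := fun j =>
            ∑ k, (if δ * n < |cnt x y j k - cntA x j * Q j k| then (1 : ℝ) else 0))
            (fun j _ => Finset.sum_nonneg fun k _ => by split_ifs <;> norm_num) (Finset.mem_univ j)
      linarith
  refine le_trans ?_ h2
  simp only [mul_sub, Finset.sum_sub_distrib, mul_one]
  rw [sum_prod_eq_one_s10 (fun i => Q (x i)) (fun i => hQ _)]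
  refine sub_le_sub_left ?_ 1
  simp only [Finset.mul_sum]
  rw [Finset.sum_comm]
  calc _ ≤ ∑ j : A, ∑ k : B, 1 / (n * δ ^ 2) := by
        refine Finset.sum_le_sum fun j _ => ?_
        rw [Finset.sum_comm]
        exact Finset.sum_le_sum fun k _ => h1 j k
    _ = _ := by simp; ring

lemma mass_lower [Fintype A] [DecidableEq A] [Fintype B] [DecidableEq B] (n : ℕ) (hn : 0 < n)
    (p : A → ℝ) (hp : IsProb p) (Q : A → B → ℝ) (hQ : IsCondProb Q) (c : ℝ) (hc : 0 < c)
    (hcQ : ∀ j k, c ≤ Q j k) (x : Fin n → A)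
    (δ : ℝ) (hδ : 0 < δ) (hx : ∀ j, |cntA x j - n * p j| ≤ 2 * δ * n)
    (hnl : Fintype.card A * Fintype.card B * (1 / (n * δ ^ 2)) ≤ 1 / 2) :
    1 / 2 * Real.exp (-(n * (mutualInfo p Q +
        3 * δ * (Fintype.card A * Fintype.card B * Real.log (1 / c))))) ≤
    ∑ y : Fin n → B, (∏ i, ∑ j, p j * Q j (y i)) *
      (if ∀ j k, |cnt x y j k - n * (p j * Q j k)| ≤ 3 * δ * n then 1 else 0) := by
  set q : B → ℝ := fun k => ∑ j, p j * Q j k with hq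
  have hqc : ∀ k, c ≤ q k := fun k => by
    calc c = ∑ j, p j * c := by rw [← Finset.sum_mul, hp.2, one_mul]
      _ ≤ _ := Finset.sum_le_sum fun j _ => mul_le_mul_of_nonneg_left (hcQ j k) (hp.1 j)
  have hq1 : ∀ k, q k ≤ 1 := fun k => by
    calc q k ≤ ∑ j, p j * 1 :=
          Finset.sum_le_sum fun j _ => mul_le_mul_of_nonneg_left ((hQ j).le_one k) (hp.1 j)
      _ = 1 := by simp [hp.2]
  have hlr : ∀ j k, |Real.log (Q j k / q k)| ≤ Real.log (1 / c) := by
    intro j k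
    have hQ0 : 0 < Q j k := hc.trans_le (hcQ j k)
    have hq0 : 0 < q k := hc.trans_le (hqc k)
    rw [abs_le, Real.log_div hQ0.ne' hq0.ne', one_div, Real.log_inv]
    have := Real.log_le_log hc (hcQ j k)
    have := Real.log_le_log hc (hqc k)
    have := Real.log_nonpos hQ0.le ((hQ j).le_one k)
    have := Real.log_nonpos hq0.le (hq1 k)
    constructor <;> linarith
  have h1 := cond_typ n hn p Q hQ x δ hδ hx
  have h2 : (1 : ℝ) / 2 ≤ ∑ y : Fin n → B, (∏ i, Q (x i) (y i)) *
      (if ∀ j k, |cnt x y j k - n * (p j * Q j k)| ≤ 3 * δ * n then 1 else 0) := by linarith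
  set D := (n * (mutualInfo p Q +
        3 * δ * (Fintype.card A * Fintype.card B * Real.log (1 / c)))) with hD
  have h3 : ∑ y : Fin n → B, (∏ i, Q (x i) (y i)) *
      (if ∀ j k, |cnt x y j k - n * (p j * Q j k)| ≤ 3 * δ * n then 1 else 0) ≤
      Real.exp D * ∑ y : Fin n → B, (∏ i, q (y i)) *
      (if ∀ j k, |cnt x y j k - n * (p j * Q j k)| ≤ 3 * δ * n then 1 else 0) := by
    rw [Finset.mul_sum]
    refine Finset.sum_le_sum fun y _ => ?_
    split_ifs with h
    · rw [mul_one, mul_one]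
      have e1 : ∏ i, Q (x i) (y i) = (Real.exp (∑ i, Real.log (Q (x i) (y i) / q (y i)))) *
          ∏ i, q (y i) := by
        rw [Real.exp_sum, ← Finset.prod_mul_distrib]
        refine Finset.prod_congr rfl fun i _ => ?_
        have hQ0 : 0 < Q (x i) (y i) := hc.trans_le (hcQ _ _)
        have hq0 : 0 < q (y i) := hc.trans_le (hqc _)
        rw [Real.exp_log (by positivity)]
        field_simp
      rw [e1]
      refine mul_le_mul_of_nonneg_right ?_
        (Finset.prod_nonneg fun i _ => hc.le.trans (hqc _))
      rw [Real.exp_le_exp, sum_cnt x y (fun j k => Real.log (Q j k / q k))]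
      calc _ ≤ ∑ j, ∑ k, (n * (p j * Q j k * Real.log (Q j k / q k)) +
            3 * δ * n * Real.log (1 / c)) := by
            refine Finset.sum_le_sum fun j _ => Finset.sum_le_sum fun k _ => ?_
            have a1 := h j k
            have a2 := hlr j k
            have a3 : (cnt x y j k - n * (p j * Q j k)) * Real.log (Q j k / q k) ≤
                3 * δ * n * Real.log (1 / c) := by
              refine (le_abs_self _).trans ?_
              rw [abs_mul]
              exact mul_le_mul a1 a2 (abs_nonneg _) (by positivity)
            linarith
        _ = D := by
            simp only [Finset.sum_add_distrib, ← Finset.mul_sum, hD, mutualInfo]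
            simp only [Finset.sum_const, Finset.card_univ, nsmul_eq_mul]
            ring
    · simp
  have h4 := h2.trans h3
  rw [Real.exp_neg, ← div_eq_mul_inv, div_le_iff₀ (Real.exp_pos _)]
  linarith

lemma covering_s10 [Fintype A] [DecidableEq A] [Nonempty A] [Fintype B] [DecidableEq B] (n : ℕ)
    (hn : 0 < n)
    (p : A → ℝ) (hp : IsProb p) (Q : A → B → ℝ) (hQ : IsCondProb Q) (c : ℝ) (hc : 0 < c)
    (hcQ : ∀ j k, c ≤ Q j k) (δ : ℝ) (hδ : 0 < δ)
    (hnl : Fintype.card A * Fintype.card B * (1 / (n * δ ^ 2)) ≤ 1 / 2) :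
    ∃ C : Finset (Fin n → B), (C.card : ℝ) ≤ 2 * (n * Real.log (Fintype.card A) + 1) *
      Real.exp (n * (mutualInfo p Q +
        3 * δ * (Fintype.card A * Fintype.card B * Real.log (1 / c)))) ∧
      ∀ x : Fin n → A, (∀ j, |cntA x j - n * p j| ≤ 2 * δ * n) →
        ∃ y ∈ C, ∀ j k, |cnt x y j k - n * (p j * Q j k)| ≤ 3 * δ * n := by
  classical
  set D := (n * (mutualInfo p Q +
        3 * δ * (Fintype.card A * Fintype.card B * Real.log (1 / c)))) with hD
  have hA1 : (1 : ℝ) ≤ Fintype.card A := by exact_mod_cast Fintype.card_pos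
  have hlog : 0 ≤ Real.log (Fintype.card A) := Real.log_nonneg hA1
  by_cases hS : ∃ x : Fin n → A, (∀ j, |cntA x j - n * p j| ≤ 2 * δ * n)
  swap
  · push Not at hS
    refine ⟨∅, by simp; positivity, fun x hx => ?_⟩
    obtain ⟨j, hj⟩ := hS x
    exact absurd (hx j) (not_le.2 hj)
  set q : B → ℝ := fun k => ∑ j, p j * Q j k with hq
  have hqp : IsProb q := by
    refine ⟨fun k => Finset.sum_nonneg fun j _ => mul_nonneg (hp.1 j) ((hQ j).1 k), ?_⟩
    rw [hq, Finset.sum_comm]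
    simp only [← Finset.mul_sum, (hQ _).2, mul_one, hp.2]
  set α := 1 / 2 * Real.exp (-D) with hα
  have hαpos : 0 < α := by positivity
  have hmass := fun x hx => mass_lower n hn p hp Q hQ c hc hcQ x δ hδ hx hnl
  have hwp : IsProb (fun y : Fin n → B => ∏ i, q (y i)) :=
    ⟨fun y => Finset.prod_nonneg fun i _ => hqp.1 _, sum_prod_eq_one_s10 _ fun _ => hqp⟩
  have hα1 : α ≤ 1 := by
    obtain ⟨x, hx⟩ := hS
    refine (hmass x hx).trans ?_
    refine le_trans (Finset.sum_le_sum fun y _ => ?_) (le_of_eq hwp.2)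
    have := hwp.1 y
    simp only at this
    split_ifs
    · rw [mul_one]
    · simpa using this
  set M := ⌊n * Real.log (Fintype.card A) / α⌋₊ + 1 with hM
  obtain ⟨C, hC, hR⟩ := greedy
    (Finset.univ.filter fun x : Fin n → A => ∀ j, |cntA x j - n * p j| ≤ 2 * δ * n)
    _ hwp (fun x y => ∀ j k, |cnt x y j k - n * (p j * Q j k)| ≤ 3 * δ * n) α hα1
    (fun x hx => hmass x (by simpa using hx)) M
  refine ⟨C, ?_, ?_⟩
  · have h1 : (C.card : ℝ) ≤ M := by exact_mod_cast hC
    have h2 : (M : ℝ) ≤ n * Real.log (Fintype.card A) / α + 1 := by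
      rw [hM]; push_cast
      have := Nat.floor_le (a := n * Real.log (Fintype.card A) / α) (by positivity)
      linarith
    have h3 : (1 : ℝ) ≤ 1 / α := by rw [le_div_iff₀ hαpos]; linarith
    have h4 : 1 / α = 2 * Real.exp D := by
      rw [hα, Real.exp_neg]; field_simp
    calc (C.card : ℝ) ≤ n * Real.log (Fintype.card A) / α + 1 / α := by linarith
      _ = (n * Real.log (Fintype.card A) + 1) * (1 / α) := by ring
      _ = _ := by rw [h4]; ring
  · have hlt : n * Real.log (Fintype.card A) < α * M := by
      have := Nat.lt_floor_add_one (n * Real.log (Fintype.card A) / α)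
      rw [div_lt_iff₀ hαpos] at this
      rw [hM]; push_cast; linarith
    have h5 : (1 - α) ^ M ≤ Real.exp (-(α * M)) := by
      have : 1 - α ≤ Real.exp (-α) := by linarith [Real.add_one_le_exp (-α)]
      calc _ ≤ (Real.exp (-α)) ^ M := pow_le_pow_left₀ (by linarith) this M
        _ = _ := by rw [← Real.exp_nat_mul]; congr 1; ring
    have h6 : ((Finset.univ.filter fun x : Fin n → A =>
        ∀ j, |cntA x j - n * p j| ≤ 2 * δ * n).card : ℝ) ≤
        Real.exp (n * Real.log (Fintype.card A)) := by
      rw [Real.exp_nat_mul, Real.exp_log (by linarith)]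
      have := Finset.card_le_univ (Finset.univ.filter fun x : Fin n → A =>
        ∀ j, |cntA x j - n * p j| ≤ 2 * δ * n)
      rw [Fintype.card_fun, Fintype.card_fin] at this
      exact_mod_cast this
    have h7 := hR.trans (mul_le_mul h5 h6 (by positivity) (by positivity))
    rw [← Real.exp_add] at h7
    have h8 : Real.exp (-(α * M) + n * Real.log (Fintype.card A)) < 1 := by
      rw [Real.exp_lt_one_iff]; linarith
    have h9 := h7.trans_lt h8
    have h10 : (Finset.filter (fun x => ∀ y ∈ C,
      ¬∀ (j : A) (k : B), |cnt x y j k - n * (p j * Q j k)| ≤ 3 * δ * n)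
      (Finset.univ.filter fun x : Fin n → A =>
        ∀ j, |cntA x j - n * p j| ≤ 2 * δ * n)).card = 0 := by
      have h11 := Nat.cast_lt_one.1 h9
      exact h11
    intro x hx
    by_contra hcon
    rw [Finset.card_eq_zero] at h10
    have : x ∈ (∅ : Finset (Fin n → A)) := by
      rw [← h10]
      simp only [Finset.mem_filter, Finset.mem_univ, true_and]
      refine ⟨hx, fun y hy hh => hcon ⟨y, hy, hh⟩⟩
    simp at this

lemma lengths {Y ι : Type*} [Fintype Y] [Fintype ι] [DecidableEq Y] (C : ι → Finset Y) (i0 : ι)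
    (h0 : C i0 = Finset.univ) :
    ∃ l : Y → ℕ, (∀ L, (Finset.univ.filter fun y => l y = L).card ≤ 2 ^ L) ∧
      ∀ i, ∀ y ∈ C i, Real.log 2 * l y ≤ Real.log (2 * Fintype.card ι * (C i).card) := by
  classical
  set N := Fintype.card ι with hN
  have hN0 : 0 < N := Fintype.card_pos_iff.2 ⟨i0⟩
  set len : ι → ℕ := fun i => Nat.log 2 (N * (C i).card) + 1 with hlen
  have hmin : ∀ y, ∃ i, y ∈ C i ∧ ∀ i', y ∈ C i' → len i ≤ len i' := by
    intro y
    obtain ⟨i, hi, hmin⟩ := Finset.exists_min_image (Finset.univ.filter fun i => y ∈ C i) len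
      ⟨i0, by simp [h0]⟩
    exact ⟨i, by simpa using hi, fun i' hi' => hmin i' (by simpa using hi')⟩
  choose I hI hImin using hmin
  refine ⟨fun y => len (I y), fun L => ?_, fun i y hy => ?_⟩
  · have h1 : (Finset.univ.filter fun y => len (I y) = L) ⊆
        (Finset.univ.filter fun i => len i = L).biUnion C := by
      intro y hy
      simp only [Finset.mem_biUnion, Finset.mem_filter, Finset.mem_univ, true_and] at hy ⊢
      exact ⟨I y, hy, hI y⟩
    have h2 := (Finset.card_le_card h1).trans Finset.card_biUnion_le
    refine h2.trans ?_
    refine Nat.le_of_mul_le_mul_left ?_ hN0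
    rw [Finset.mul_sum]
    calc _ ≤ ∑ i ∈ Finset.univ.filter (fun i => len i = L), 2 ^ L := by
          refine Finset.sum_le_sum fun i hi => ?_
          simp only [Finset.mem_filter, Finset.mem_univ, true_and] at hi
          rw [← hi]
          exact (Nat.lt_pow_succ_log_self (by norm_num) _).le
      _ ≤ _ := by
          rw [Finset.sum_const, smul_eq_mul]
          exact Nat.mul_le_mul_right _ (Finset.card_le_univ _)
  · have hpos : 0 < (C i).card := Finset.card_pos.2 ⟨y, hy⟩
    have h1 : len (I y) ≤ len i := hImin y i hy
    have h2 : Real.log 2 * (len (I y) : ℝ) ≤ Real.log 2 * len i :=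
      mul_le_mul_of_nonneg_left (by exact_mod_cast h1) (Real.log_nonneg (by norm_num))
    refine h2.trans ?_
    rw [mul_comm, ← Real.log_pow]
    refine Real.log_le_log (by positivity) ?_
    rw [hlen]
    have := Nat.pow_log_le_self 2 (x := N * (C i).card) (by positivity)
    have h3 : (2 : ℝ) ^ (Nat.log 2 (N * (C i).card)) ≤ N * (C i).card := by exact_mod_cast this
    rw [pow_succ]; linarith

/-- continuous version of the mutual information -/
def mutualG [Fintype A] [Fintype B] (u : (A → ℝ) × (A → B → ℝ)) : ℝ :=
  ∑ j, ∑ k, (-(u.1 j * Real.negMulLog (u.2 j k))) + ∑ k, Real.negMulLog (∑ j, u.1 j * u.2 j k)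

lemma mutualInfo_eq_G [Fintype A] [Fintype B] (p : A → ℝ) (Q : A → B → ℝ) (hp : IsProb p)
    (hQ : IsCondProb Q) : mutualInfo p Q = mutualG (p, Q) := by
  have h : ∀ j k, p j * Q j k * Real.log (Q j k / ∑ j', p j' * Q j' k) =
      -(p j * Real.negMulLog (Q j k)) - p j * Q j k * Real.log (∑ j', p j' * Q j' k) := by
    intro j k
    by_cases h0 : p j * Q j k = 0
    · rw [h0, Real.negMulLog]
      have : p j * (-Q j k * Real.log (Q j k)) = -(p j * Q j k) * Real.log (Q j k) := by ring
      rw [this, h0]; simp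
    · have hQ0 : Q j k ≠ 0 := right_ne_zero_of_mul h0
      have h1 : p j * Q j k ≤ ∑ j', p j' * Q j' k :=
        Finset.single_le_sum (f := fun j' => p j' * Q j' k)
          (fun i _ => mul_nonneg (hp.1 i) ((hQ i).1 k)) (Finset.mem_univ j)
      have h2 : 0 < p j * Q j k :=
        lt_of_le_of_ne (mul_nonneg (hp.1 j) ((hQ j).1 k)) (Ne.symm h0)
      rw [Real.log_div hQ0 (h2.trans_le h1).ne', Real.negMulLog]
      ring
  unfold mutualInfo mutualG
  simp only [h, Finset.sum_sub_distrib]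
  rw [sub_eq_add_neg]
  congr 1
  rw [Finset.sum_comm, ← Finset.sum_neg_distrib]
  refine Finset.sum_congr rfl fun k _ => ?_
  rw [← Finset.sum_mul, Real.negMulLog]
  ring

lemma mutualG_cont [Fintype A] [Fintype B] :
    Continuous (mutualG : (A → ℝ) × (A → B → ℝ) → ℝ) := by
  unfold mutualG
  have := Real.continuous_negMulLog
  fun_prop

lemma prob_box [Fintype A] [Fintype B] (p : A → ℝ) (Q : A → B → ℝ) (hp : IsProb p)
    (hQ : IsCondProb Q) : ((p, Q) : (A → ℝ) × (A → B → ℝ)) ∈ Set.Icc 0 1 :=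
  ⟨⟨fun j => hp.1 j, fun j k => (hQ j).1 k⟩, ⟨fun j => hp.le_one j, fun j k => (hQ j).le_one k⟩⟩

lemma sum_zero_ker [Fintype A] [Fintype B] [DecidableEq B] (Z : A → B) (j : A) :
    IsProb (fun k : B => if k = Z j then (1 : ℝ) else 0) :=
  ⟨fun k => by dsimp only; split_ifs <;> norm_num, by simp⟩

lemma net [Fintype A] [Fintype B] [Nonempty A] [Nonempty B]
    (ρmax : ℝ) (hρmax : 0 < ρmax) (d : ℝ) (hd : 0 < d) (ε : ℝ) (hε : 0 < ε) :
    ∃ (c δ : ℝ) (t : Finset ((A → ℝ) × (A → B → ℝ))), 0 < c ∧ 0 < δ ∧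
      3 * δ * (Fintype.card A * Fintype.card B * Real.log (1 / c)) ≤ ε ∧
      (∀ u ∈ t, IsProb u.1 ∧ IsCondProb u.2 ∧ ∀ j k, c ≤ u.2 j k) ∧
      ∀ p ρ, IsProb p → IsDistMeasure ρmax ρ → ∃ u ∈ t, (∀ j, |p j - u.1 j| ≤ δ) ∧
        mutualInfo u.1 u.2 ≤ RD p d ρ + 3 * ε ∧
        ∀ P : A → B → ℝ, (∀ j k, |P j k - u.1 j * u.2 j k| ≤ 3 * δ) →
          ∑ j, ∑ k, P j k * ρ j k ≤ d := by
  classical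
  have hJ : (0 : ℝ) < Fintype.card A := by exact_mod_cast Fintype.card_pos
  have hK : (0 : ℝ) < Fintype.card B := by exact_mod_cast Fintype.card_pos
  have hK1 : (1 : ℝ) ≤ Fintype.card B := by exact_mod_cast Fintype.card_pos
  have huc : UniformContinuousOn mutualG (Set.Icc (0 : (A → ℝ) × (A → B → ℝ)) 1) :=
    isCompact_Icc.uniformContinuousOn_of_continuous mutualG_cont.continuousOn
  rw [Metric.uniformContinuousOn_iff] at huc
  obtain ⟨r, hr, huc⟩ := huc ε hε
  set lam := min (r / 2) (1 / 2) with hlam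
  have hlam0 : 0 < lam := by positivity
  have hlam1 : lam ≤ 1 / 2 := min_le_right _ _
  have hlamr : lam < r := (min_le_left _ _).trans_lt (by linarith)
  set mu := min 1 (d / (2 * ρmax)) with hmu
  have hmu0 : 0 < mu := by positivity
  have hmu1 : mu ≤ 1 := min_le_left _ _
  have hmud : mu * ρmax ≤ d / 2 := by
    have : mu ≤ d / (2 * ρmax) := min_le_right _ _
    rw [le_div_iff₀ (by positivity)] at this
    linarith
  set c := lam * mu / Fintype.card B with hc
  have hc0 : 0 < c := by positivity
  have hc1 : c ≤ 1 := by
    rw [hc, div_le_iff₀ hK]; nlinarith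
  have hlogc : 0 ≤ Real.log (1 / c) := Real.log_nonneg (by rw [le_div_iff₀ hc0]; linarith)
  set X := 3 * (Fintype.card A * Fintype.card B * Real.log (1 / c)) + 1 with hX
  have hX0 : 0 < X := by positivity
  set V := 5 * (Fintype.card A * Fintype.card B * ρmax) with hV
  have hV0 : 0 < V := by positivity
  set δ := min (r / 2) (min (ε / X) (lam * d / 2 / V)) with hδ
  have hδ0 : 0 < δ := by positivity
  have hδr : δ < r := (min_le_left _ _).trans_lt (by linarith)
  have hδX : δ * X ≤ ε := by
    rw [← le_div_iff₀ hX0]; exact (min_le_right _ _).trans (min_le_left _ _)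
  have hδV : δ * V ≤ lam * d / 2 := by
    rw [← le_div_iff₀ hV0]; exact (min_le_right _ _).trans (min_le_right _ _)
  set S : Set ((A → ℝ) × (A → B → ℝ)) :=
    {u | IsProb u.1 ∧ IsCondProb u.2 ∧ ∀ j k, c ≤ u.2 j k} with hS
  have hSb : S ⊆ Set.Icc 0 1 := fun u hu => prob_box u.1 u.2 hu.1 hu.2.1
  have hST : TotallyBounded S := (isCompact_Icc.totallyBounded).subset hSb
  obtain ⟨t, htS, htf, hcov⟩ := Metric.finite_approx_of_totallyBounded hST δ hδ0
  refine ⟨c, δ, htf.toFinset, hc0, hδ0, ?_, ?_, ?_⟩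
  · rw [hX] at hδX; nlinarith
  · intro u hu
    exact htS (by simpa using hu)
  intro p ρ hp hρ
  choose Z hZ using hρ.2
  set Q0 : A → B → ℝ := fun j k => if k = Z j then 1 else 0 with hQ0def
  have hQ0 : IsCondProb Q0 := fun j => sum_zero_ker Z j
  have hne : { r | ∃ Q, IsCondProb Q ∧ avgDist p Q ρ ≤ d ∧ r = mutualInfo p Q }.Nonempty := by
    refine ⟨_, Q0, hQ0, ?_, rfl⟩
    have : avgDist p Q0 ρ = 0 := by
      simp [avgDist, hQ0def, hZ]
    rw [this]; exact hd.le
  obtain ⟨_, ⟨Q, hQ, hQd, rfl⟩, hQI⟩ := Real.lt_sInf_add_pos hne hε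
  change mutualInfo p Q < RD p d ρ + ε at hQI
  set W : A → B → ℝ := fun j k => (1 - mu) * Q0 j k + mu / Fintype.card B with hWdef
  have hW : IsCondProb W := by
    intro j
    refine ⟨fun k => add_nonneg (mul_nonneg (by linarith) ((hQ0 j).1 k)) (by positivity), ?_⟩
    simp only [hWdef, Finset.sum_add_distrib, ← Finset.mul_sum, (hQ0 j).2]
    simp only [Finset.sum_const, Finset.card_univ, nsmul_eq_mul]
    field_simp; ring
  set Q' : A → B → ℝ := fun j k => (1 - lam) * Q j k + lam * W j k with hQ'def
  have hQ' : IsCondProb Q' := by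
    intro j
    refine ⟨fun k => add_nonneg (mul_nonneg (by linarith) ((hQ j).1 k))
      (mul_nonneg hlam0.le ((hW j).1 k)), ?_⟩
    simp only [hQ'def, Finset.sum_add_distrib, ← Finset.mul_sum, (hQ j).2, (hW j).2]
    ring
  have hQ'c : ∀ j k, c ≤ Q' j k := by
    intro j k
    have h1 : mu / Fintype.card B ≤ W j k :=
      le_add_of_nonneg_left (mul_nonneg (by linarith) ((hQ0 j).1 k))
    have h2 : lam * (mu / Fintype.card B) ≤ lam * W j k := mul_le_mul_of_nonneg_left h1 hlam0.le
    have h3 : 0 ≤ (1 - lam) * Q j k := mul_nonneg (by linarith) ((hQ j).1 k)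
    rw [hc, mul_div_assoc]
    simp only [hQ'def]
    linarith
  have hWd : avgDist p W ρ ≤ d / 2 := by
    calc avgDist p W ρ ≤ ∑ j, ∑ k, p j * (mu / Fintype.card B * ρmax) := by
          refine Finset.sum_le_sum fun j _ => Finset.sum_le_sum fun k _ => ?_
          have h1 : Q0 j k * ρ j k = 0 := by
            simp only [hQ0def]
            split_ifs with h
            · rw [h, hZ, mul_zero]
            · simp
          have h2 : p j * W j k * ρ j k = p j * (mu / Fintype.card B * ρ j k) := by
            simp only [hWdef]
            linear_combination p j * (1 - mu) * h1
          rw [h2]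
          have := (hρ.1 j k).2
          have := hp.1 j
          gcongr
      _ = mu * ρmax := by
          simp only [Finset.sum_const, Finset.card_univ, nsmul_eq_mul, ← Finset.mul_sum,
            ← Finset.sum_mul, hp.2]
          field_simp
      _ ≤ _ := hmud
  have hQ'd : avgDist p Q' ρ ≤ d - lam * d / 2 := by
    have : avgDist p Q' ρ = (1 - lam) * avgDist p Q ρ + lam * avgDist p W ρ := by
      simp only [avgDist, Finset.mul_sum, ← Finset.sum_add_distrib]
      refine Finset.sum_congr rfl fun j _ => Finset.sum_congr rfl fun k _ => ?_
      simp only [hQ'def]; ring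
    rw [this]
    have h1 := mul_le_mul_of_nonneg_left hQd (by linarith : 0 ≤ 1 - lam)
    have h2 := mul_le_mul_of_nonneg_left hWd hlam0.le
    linarith
  have hI' : mutualInfo p Q' ≤ mutualInfo p Q + ε := by
    have hdist : dist ((p, Q') : (A → ℝ) × (A → B → ℝ)) (p, Q) ≤ lam := by
      rw [Prod.dist_eq, dist_self]
      refine max_le hlam0.le ?_
      refine (dist_pi_le_iff hlam0.le).2 fun j => (dist_pi_le_iff hlam0.le).2 fun k => ?_
      rw [Real.dist_eq]
      have e : Q' j k - Q j k = lam * (W j k - Q j k) := by simp only [hQ'def]; ring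
      rw [e, abs_mul, abs_of_pos hlam0]
      have : |W j k - Q j k| ≤ 1 := by
        have := (hQ j).1 k
        have := (hQ j).le_one k
        have := (hW j).1 k
        have := (hW j).le_one k
        rw [abs_le]; constructor <;> linarith
      nlinarith
    have := huc _ (prob_box p Q' hp hQ') _ (prob_box p Q hp hQ) (hdist.trans_lt hlamr)
    rw [← mutualInfo_eq_G _ _ hp hQ', ← mutualInfo_eq_G _ _ hp hQ, Real.dist_eq, abs_lt] at this
    linarith
  have hmem : ((p, Q') : (A → ℝ) × (A → B → ℝ)) ∈ S := ⟨hp, hQ', hQ'c⟩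
  have := hcov hmem
  simp only [Set.mem_iUnion, Metric.mem_ball, exists_prop] at this
  obtain ⟨u, hut, hdu⟩ := this
  obtain ⟨hu1, hu2, hu3⟩ := htS hut
  have hd1 : ∀ j, |p j - u.1 j| ≤ δ := fun j => by
    rw [← Real.dist_eq]
    exact (dist_le_pi_dist p u.1 j).trans ((le_max_left _ _).trans hdu.le)
  have hd2 : ∀ j k, |Q' j k - u.2 j k| ≤ δ := fun j k => by
    rw [← Real.dist_eq]
    exact (dist_le_pi_dist (Q' j) (u.2 j) k).trans ((dist_le_pi_dist Q' u.2 j).trans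
      ((le_max_right _ _).trans hdu.le))
  refine ⟨u, by simpa using hut, hd1, ?_, ?_⟩
  · have := huc _ (hSb hmem) _ (hSb (htS hut)) (hdu.trans hδr)
    rw [← mutualInfo_eq_G _ _ hp hQ', ← Prod.mk.eta (p := u), ← mutualInfo_eq_G _ _ hu1 hu2,
      Real.dist_eq, abs_lt] at this
    linarith
  · intro P hP
    have h1 : ∀ j k, P j k * ρ j k ≤ p j * Q' j k * ρ j k + 5 * δ * ρmax := by
      intro j k
      have a1 := hP j k
      have a2 : |u.1 j * u.2 j k - p j * Q' j k| ≤ 2 * δ := by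
        have e : u.1 j * u.2 j k - p j * Q' j k =
          -((p j - u.1 j) * u.2 j k + p j * (Q' j k - u.2 j k)) := by ring
        rw [e, abs_neg]
        refine (abs_add_le _ _).trans ?_
        rw [abs_mul, abs_mul, abs_of_nonneg ((hu2 j).1 k), abs_of_nonneg (hp.1 j)]
        have b1 := mul_le_mul (hd1 j) ((hu2 j).le_one k) ((hu2 j).1 k) hδ0.le
        have b2 := mul_le_mul (hp.le_one j) (hd2 j k) (abs_nonneg _) zero_le_one
        linarith
      have a3 : P j k - p j * Q' j k ≤ 5 * δ := by
        have := (abs_le.1 a1).2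
        have := (abs_le.1 a2).2
        linarith
      have a4 := mul_le_mul_of_nonneg_right a3 (hρ.1 j k).1
      have a5 := mul_le_mul_of_nonneg_left (hρ.1 j k).2 (by positivity : 0 ≤ 5 * δ)
      linarith
    calc _ ≤ ∑ j, ∑ k, (p j * Q' j k * ρ j k + 5 * δ * ρmax) :=
          Finset.sum_le_sum fun j _ => Finset.sum_le_sum fun k _ => h1 j k
      _ = avgDist p Q' ρ + δ * V := by
          simp only [Finset.sum_add_distrib, avgDist, Finset.sum_const, Finset.card_univ,
            nsmul_eq_mul, hV]
          ring
      _ ≤ d := by linarith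

lemma eventually_small (a b e ε : ℝ) (hε : 0 < ε) :
    ∀ᶠ n : ℕ in atTop, (a + Real.log n) / n ≤ ε ∧ b * (1 / n) ≤ 1 / 2 ∧
      b * (1 / n) * (e / n) ≤ ε ∧ b * (1 / n) * e ≤ ε ∧ 0 < n := by
  have h1 : Tendsto (fun n : ℕ => (1 : ℝ) / n) atTop (nhds 0) := tendsto_one_div_atTop_nhds_zero_nat
  have h2 : Tendsto (fun n : ℕ => Real.log n / n) atTop (nhds 0) := by
    have := (Real.isLittleO_log_id_atTop.tendsto_div_nhds_zero).comp tendsto_natCast_atTop_atTop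
    exact this
  have h3 : Tendsto (fun n : ℕ => (a + Real.log n) / n) atTop (nhds 0) := by
    have := (h1.const_mul a).add h2
    simp only [mul_zero, add_zero] at this
    refine this.congr fun n => ?_
    ring
  have h4 : Tendsto (fun n : ℕ => b * ((1 : ℝ) / n)) atTop (nhds 0) := by
    simpa using h1.const_mul b
  have h5 : Tendsto (fun n : ℕ => b * ((1 : ℝ) / n) * e) atTop (nhds 0) := by
    simpa using h4.mul_const e
  have h6 : Tendsto (fun n : ℕ => b * ((1 : ℝ) / n) * (e / n)) atTop (nhds 0) := by
    have := h5.mul h1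
    simp only [mul_zero] at this
    refine this.congr fun n => ?_
    ring
  filter_upwards [h3.eventually_le_const hε, h4.eventually_le_const (by norm_num : (0 : ℝ) < 1 / 2),
    h6.eventually_le_const hε, h5.eventually_le_const hε, eventually_gt_atTop 0] with n a1 a2 a3 a4 a5
  exact ⟨a1, a2, a3, a4, a5⟩

lemma achiev [Fintype A] [DecidableEq A] [Fintype B] [DecidableEq B] [Nonempty A] [Nonempty B]
    (ρmax : ℝ) (hρmax : 0 < ρmax) (d : ℝ) (hd : 0 < d) (ε : ℝ) (hε : 0 < ε) :
    ∀ᶠ n : ℕ in atTop, ∃ (φ : (Fin n → A) → (A → B → ℝ) → (Fin n → B))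
          (f : (Fin n → B) → List Bool) (g : List Bool → (Fin n → B)),
          (∀ x ρ, IsDistMeasure ρmax ρ → nDist ρ x (φ x ρ) ≤ d) ∧
          (∀ x ρ, IsDistMeasure ρmax ρ → g (f (φ x ρ)) = φ x ρ) ∧
          ∀ p ρ, IsProb p → IsDistMeasure ρmax ρ →
            (Real.log 2 / n) * (∑ x : Fin n → A, prodProb p x * ((f (φ x ρ)).length : ℝ))
                    - RD p d ρ ≤ 7 * ε := by
  classical
  obtain ⟨c, δ, t, hc, hδ, hD, ht, hnet⟩ := net (A := A) (B := B) ρmax hρmax d hd ε hε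
  have hJ1 : (1 : ℝ) ≤ Fintype.card A := by exact_mod_cast Fintype.card_pos
  have hK1 : (1 : ℝ) ≤ Fintype.card B := by exact_mod_cast Fintype.card_pos
  have hlogJ : 0 ≤ Real.log (Fintype.card A) := Real.log_nonneg hJ1
  have hlogK : 0 ≤ Real.log (Fintype.card B) := Real.log_nonneg hK1
  set N := Fintype.card (Option t) with hN
  have hN1 : (1 : ℝ) ≤ N := by exact_mod_cast Fintype.card_pos
  set b : ℝ := Fintype.card A * Fintype.card B / δ ^ 2 with hb
  set a : ℝ := 4 * N * (Real.log (Fintype.card A) + 1) with ha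
  have ha0 : 0 < a := by positivity
  filter_upwards [eventually_small (Real.log a) b (Real.log (2 * N)) ε hε,
    eventually_small (Real.log a) b (Real.log (Fintype.card B)) ε hε] with n hn1 hn2
  obtain ⟨s1, s2, s3, -, hn⟩ := hn1
  obtain ⟨-, -, -, s4, -⟩ := hn2
  have hn' : (0 : ℝ) < n := by exact_mod_cast hn
  have hn1' : (1 : ℝ) ≤ n := by exact_mod_cast hn
  have hnl : Fintype.card A * Fintype.card B * (1 / (n * δ ^ 2)) ≤ 1 / 2 := by
    refine le_trans (le_of_eq ?_) s2
    rw [hb]; field_simp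
  have hcov := fun u : t => covering_s10 n hn u.1.1 (ht u u.2).1 u.1.2 (ht u u.2).2.1 c hc
    (ht u u.2).2.2 δ hδ hnl
  choose C hC1 hC2 using hcov
  obtain ⟨l, hl1, hl2⟩ := lengths (fun o : Option t => o.elim Finset.univ C) none rfl
  obtain ⟨f, g, hfg, hfl⟩ := encode l hl1
  have hphi : ∀ (x : Fin n → A) (ρ : A → B → ℝ), ∃ y : Fin n → B, IsDistMeasure ρmax ρ →
      nDist ρ x y ≤ d ∧ ∀ y', nDist ρ x y' ≤ d → l y ≤ l y' := by
    intro x ρ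
    by_cases hρ : IsDistMeasure ρmax ρ
    · choose Z hZ using hρ.2
      obtain ⟨y, hy, hmin⟩ := Finset.exists_min_image
        (Finset.univ.filter fun y : Fin n → B => nDist ρ x y ≤ d) l
        ⟨fun i => Z (x i), by rw [Finset.mem_filter]; exact ⟨Finset.mem_univ _, by simp [nDist, hZ, hd.le]⟩⟩
      exact ⟨y, fun _ => ⟨by simpa using hy, fun y' hy' => hmin y' (by simpa using hy')⟩⟩
    · exact ⟨Classical.arbitrary _, fun h => absurd h hρ⟩
  choose φ hφ using hphi
  refine ⟨φ, f, g, fun x ρ hρ => (hφ x ρ hρ).1, fun x ρ _ => hfg _, ?_⟩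
  intro p ρ hp hρ
  simp only [hfl]
  obtain ⟨u, hut, hpu, hIu, hPu⟩ := hnet p ρ hp hρ
  set U := Real.log a + Real.log n + n * (RD p d ρ + 4 * ε) with hU
  set V := Real.log (2 * N) + n * Real.log (Fintype.card B) with hV
  have hV0 : 0 ≤ V := add_nonneg (Real.log_nonneg (by linarith)) (by positivity)
  have hall : ∀ x, Real.log 2 * l (φ x ρ) ≤ V := by
    intro x
    have := hl2 none (φ x ρ) (by simp)
    refine this.trans (le_of_eq ?_)
    simp only [Option.elim_none, Finset.card_univ, Fintype.card_fun, Fintype.card_fin]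
    push_cast
    rw [Real.log_mul (by positivity) (by positivity), Real.log_pow]
  have htyp : ∀ x : Fin n → A, (∀ j, |cntA x j - n * p j| ≤ δ * n) →
      Real.log 2 * l (φ x ρ) ≤ U := by
    intro x hx
    obtain ⟨y, hyC, hy⟩ := hC2 ⟨u, hut⟩ x (by
      intro j
      have e : cntA x j - n * u.1 j = (cntA x j - n * p j) + n * (p j - u.1 j) := by ring
      simp only [e]
      refine (abs_add_le _ _).trans ?_
      rw [abs_mul, abs_of_pos hn']
      have := mul_le_mul_of_nonneg_left (hpu j) hn'.le
      have := hx j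
      linarith)
    simp only at hy
    have hyd : nDist ρ x y ≤ d := by
      have h1 := hPu (fun j k => cnt x y j k / n) (by
        intro j k
        have e : cnt x y j k / n - u.1 j * u.2 j k =
            (cnt x y j k - n * (u.1 j * u.2 j k)) / n := by field_simp
        simp only [e]
        rw [abs_div, abs_of_pos hn', div_le_iff₀ hn']
        exact hy j k)
      refine le_trans (le_of_eq ?_) h1
      rw [nDist, sum_cnt, Finset.sum_div]
      refine Finset.sum_congr rfl fun j _ => ?_
      rw [Finset.sum_div]
      refine Finset.sum_congr rfl fun k _ => ?_
      ring
    have h2 : (l (φ x ρ) : ℝ) ≤ l y := by exact_mod_cast (hφ x ρ hρ).2 y hyd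
    have h3 := mul_le_mul_of_nonneg_left h2 (Real.log_nonneg (by norm_num : (1 : ℝ) ≤ 2))
    have h4 := hl2 (some ⟨u, hut⟩) y (by simpa using hyC)
    refine (h3.trans h4).trans ?_
    simp only [Option.elim_some]
    have hcp : (0 : ℝ) < (C ⟨u, hut⟩).card := by exact_mod_cast Finset.card_pos.2 ⟨y, hyC⟩
    have h5 := hC1 ⟨u, hut⟩
    simp only at h5
    have h6 : 2 * N * ((C ⟨u, hut⟩).card : ℝ) ≤ a * n * Real.exp (n * (RD p d ρ + 4 * ε)) := by
      have h7 : Real.exp (n * (mutualInfo u.1 u.2 +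
          3 * δ * (Fintype.card A * Fintype.card B * Real.log (1 / c)))) ≤
          Real.exp (n * (RD p d ρ + 4 * ε)) := by
        rw [Real.exp_le_exp]
        refine mul_le_mul_of_nonneg_left ?_ hn'.le
        linarith
      have h8 : 2 * (n * Real.log (Fintype.card A) + 1) ≤
          2 * ((Real.log (Fintype.card A) + 1) * n) := by linarith
      have h9 := h5.trans (mul_le_mul h8 h7 (Real.exp_pos _).le (by positivity))
      refine (mul_le_mul_of_nonneg_left h9 (by positivity)).trans (le_of_eq ?_)
      rw [ha]; ring
    refine (Real.log_le_log (by positivity) h6).trans (le_of_eq ?_)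
    rw [Real.log_mul (by positivity) (by positivity), Real.log_exp,
      Real.log_mul (by positivity) (by positivity)]
  have hsrc := source_typ n hn p hp δ hδ
  have hb0 : 0 ≤ b := by positivity
  have hPb : (Fintype.card A : ℝ) * (1 / (n * δ ^ 2)) ≤ b * (1 / n) := by
    have : b * (1 / n) = (Fintype.card A : ℝ) * (1 / (n * δ ^ 2)) * Fintype.card B := by
      rw [hb]; field_simp
    rw [this]
    exact le_mul_of_one_le_right (by positivity) hK1
  have hsum1 : ∑ x : Fin n → A, prodProb p x = 1 := sum_prod_eq_one_s10 (fun _ => p) (fun _ => hp)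
  have hU0 : 0 ≤ U := by
    by_cases hex : ∃ x : Fin n → A, ∀ j, |cntA x j - n * p j| ≤ δ * n
    · obtain ⟨x, hx⟩ := hex
      refine le_trans ?_ (htyp x hx)
      have := Real.log_nonneg (by norm_num : (1 : ℝ) ≤ 2)
      positivity
    · exfalso
      have h1 : ∀ x : Fin n → A, ¬ ∀ j, |cntA x j - n * p j| ≤ δ * n := fun x hx => hex ⟨x, hx⟩
      simp only [h1, if_false, mul_one, hsum1] at hsrc
      linarith
  have hmain : Real.log 2 * ∑ x : Fin n → A, prodProb p x * (l (φ x ρ) : ℝ) ≤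
      U + b * (1 / n) * V := by
    calc _ ≤ ∑ x : Fin n → A, (prodProb p x * U + (prodProb p x *
          (if ∀ j, |cntA x j - n * p j| ≤ δ * n then 0 else 1)) * V) := by
          rw [Finset.mul_sum]
          refine Finset.sum_le_sum fun x _ => ?_
          have hpp : 0 ≤ prodProb p x := Finset.prod_nonneg fun i _ => hp.1 _
          have : Real.log 2 * l (φ x ρ) ≤ U +
              (if ∀ j, |cntA x j - n * p j| ≤ δ * n then 0 else 1) * V := by
            split_ifs with h
            · simpa using htyp x h
            · linarith [hall x]
          have := mul_le_mul_of_nonneg_left this hpp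
          linarith
      _ = U + (∑ x : Fin n → A, prodProb p x *
          (if ∀ j, |cntA x j - n * p j| ≤ δ * n then 0 else 1)) * V := by
          rw [Finset.sum_add_distrib, ← Finset.sum_mul, ← Finset.sum_mul, hsum1, one_mul]
      _ ≤ _ := by
          have := mul_le_mul_of_nonneg_right (hsrc.trans hPb) hV0
          linarith
  have hdiv := div_le_div_of_nonneg_right hmain hn'.le
  have e1 : (U + b * (1 / n) * V) / n = (Real.log a + Real.log n) / n + (RD p d ρ + 4 * ε)
      + (b * (1 / n) * (Real.log (2 * N) / n) + b * (1 / n) * Real.log (Fintype.card B)) := by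
    rw [hU, hV]; field_simp
  rw [e1] at hdiv
  rw [div_mul_eq_mul_div]
  linarith

lemma sup_nonneg (J K : ℕ) (hJ : 0 < J) (hK : 0 < K)
    (ρmax : ℝ) (hρmax : 0 < ρmax) (d : ℝ) (hd : 0 < d) (n : ℕ)
    (F : (Fin n → Fin J) → (Fin J → Fin K → ℝ) → ℝ) (hF : ∀ x ρ, 0 ≤ F x ρ) :
    0 ≤ sSup { v : ℝ | ∃ (p : Fin J → ℝ) (ρ : Fin J → Fin K → ℝ),
                IsProb p ∧ IsDistMeasure ρmax ρ ∧
                v = (Real.log 2 / n) * (∑ x : Fin n → Fin J, prodProb p x * F x ρ)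
                    - RD p d ρ } := by
  classical
  set T := { v : ℝ | ∃ (p : Fin J → ℝ) (ρ : Fin J → Fin K → ℝ),
                IsProb p ∧ IsDistMeasure ρmax ρ ∧
                v = (Real.log 2 / n) * (∑ x : Fin n → Fin J, prodProb p x * F x ρ)
                    - RD p d ρ } with hT
  by_cases hb : BddAbove T
  swap
  · rw [Real.sSup_of_not_bddAbove hb]
  let j0 : Fin J := ⟨0, hJ⟩
  let k0 : Fin K := ⟨0, hK⟩
  let p : Fin J → ℝ := fun j => if j = j0 then 1 else 0
  have hp : IsProb p := ⟨fun j => by simp only [p]; split_ifs <;> norm_num, by simp [p]⟩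
  let ρ : Fin J → Fin K → ℝ := fun _ _ => 0
  have hρ : IsDistMeasure ρmax ρ := ⟨fun j k => ⟨le_rfl, hρmax.le⟩, fun j => ⟨k0, rfl⟩⟩
  have hRD : RD p d ρ ≤ 0 := by
    unfold RD
    set R := { r | ∃ Q, IsCondProb Q ∧ avgDist p Q ρ ≤ d ∧ r = mutualInfo p Q }
    by_cases hR : BddBelow R
    · refine csInf_le hR ⟨fun _ k => if k = k0 then 1 else 0, fun j => ?_, ?_, ?_⟩
      · exact ⟨fun k => by dsimp only; split_ifs <;> norm_num, by simp⟩
      · simp [avgDist, ρ, hd.le]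
      · simp [mutualInfo, p]
    · rw [Real.sInf_of_not_bddBelow hR]
  refine le_trans ?_ (le_csSup hb ⟨p, ρ, hp, hρ, rfl⟩)
  have h1 : 0 ≤ ∑ x : Fin n → Fin J, prodProb p x * F x ρ :=
    Finset.sum_nonneg fun x _ => mul_nonneg (Finset.prod_nonneg fun i _ => hp.1 _) (hF _ _)
  have h2 : 0 ≤ Real.log 2 / n := div_nonneg (Real.log_nonneg (by norm_num)) (by positivity)
  have := mul_nonneg h2 h1
  linarith

/-- Corollary 2: for fixed `d > 0`, the minimax redundancy over
deterministic (not necessarily prefix) `d`-semifaithful codes in the universal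
distortion setting tends to `0` as `n → ∞`. -/
theorem minimax_arbitrary_universal (J K : ℕ) (hJ : 0 < J) (hK : 0 < K)
    (ρmax : ℝ) (hρmax : 0 < ρmax) (d : ℝ) (hd : 0 < d) :
    Tendsto (fun n : ℕ =>
      sInf { r : ℝ |
        ∃ (φ : (Fin n → Fin J) → (Fin J → Fin K → ℝ) → (Fin n → Fin K))
          (f : (Fin n → Fin K) → List Bool)
          (g : List Bool → (Fin n → Fin K)),
          (∀ x ρ, IsDistMeasure ρmax ρ → nDist ρ x (φ x ρ) ≤ d) ∧
          (∀ x ρ, IsDistMeasure ρmax ρ → g (f (φ x ρ)) = φ x ρ) ∧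
          r = sSup { v : ℝ | ∃ (p : Fin J → ℝ) (ρ : Fin J → Fin K → ℝ),
                IsProb p ∧ IsDistMeasure ρmax ρ ∧
                v = (Real.log 2 / n) *
                      (∑ x : Fin n → Fin J, prodProb p x * ((f (φ x ρ)).length : ℝ))
                    - RD p d ρ } })
      atTop (nhds 0) := by
  have : Nonempty (Fin J) := ⟨⟨0, hJ⟩⟩
  have : Nonempty (Fin K) := ⟨⟨0, hK⟩⟩
  rw [Metric.tendsto_nhds]
  intro ε hε
  filter_upwards [achiev (A := Fin J) (B := Fin K) ρmax hρmax d hd (ε / 8) (by positivity)]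
    with n hn
  obtain ⟨φ, f, g, h1, h2, h3⟩ := hn
  rw [Real.dist_eq, sub_zero, abs_lt]
  have hnn : ∀ r ∈ { r : ℝ |
        ∃ (φ : (Fin n → Fin J) → (Fin J → Fin K → ℝ) → (Fin n → Fin K))
          (f : (Fin n → Fin K) → List Bool)
          (g : List Bool → (Fin n → Fin K)),
          (∀ x ρ, IsDistMeasure ρmax ρ → nDist ρ x (φ x ρ) ≤ d) ∧
          (∀ x ρ, IsDistMeasure ρmax ρ → g (f (φ x ρ)) = φ x ρ) ∧
          r = sSup { v : ℝ | ∃ (p : Fin J → ℝ) (ρ : Fin J → Fin K → ℝ),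
                IsProb p ∧ IsDistMeasure ρmax ρ ∧
                v = (Real.log 2 / n) *
                      (∑ x : Fin n → Fin J, prodProb p x * ((f (φ x ρ)).length : ℝ))
                    - RD p d ρ } }, 0 ≤ r := by
    rintro r ⟨φ, f, g, -, -, rfl⟩
    exact sup_nonneg J K hJ hK ρmax hρmax d hd n (fun x ρ => ((f (φ x ρ)).length : ℝ))
      (fun x ρ => Nat.cast_nonneg _)
  constructor
  · exact lt_of_lt_of_le (by linarith) (Real.sInf_nonneg hnn)
  · refine lt_of_le_of_lt (csInf_le ⟨0, fun r hr => hnn r hr⟩ ⟨φ, f, g, h1, h2, rfl⟩) ?_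
    refine lt_of_le_of_lt (Real.sSup_le (a := 7 * (ε / 8)) ?_ (by positivity)) (by linarith)
    rintro v ⟨p, ρ, hp, hρ, rfl⟩
    exact h3 p ρ hp hρ
end
end
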